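/- arXiv:math/9804125 — 3 statements merged into one kernel-verified Lean document; each statement's English description precedes it below -/
import Mathlib

section
/- Assume g satisfies conditions (2.4), let N ≥ 2, and let q₀ > 0 and c₁ > 0 satisfy the inequalities (1/N)∫₀^{q₀} s G(s²) ds < c₁ < ∫₀^{q₀} s G(s²) ds. Then there exist radii 0 < r₁ < r₀, with r₀ determined by g(q₀²) q₀ r₀^{N−1} = r₀^N − r₁^N, and a radial function u on the annulus Ω = {x ∈ ℝ^N : r₁ < |x| < r₀}, namely u(x) = ∫_{r₀}^{|x|} φ(t) dt where φ is the inverse of the strictly increasing function ψ : [0,∞) → [r₁,∞) defined implicitly by g(s²)s = (1 − r₁^N ψ(s)^{−N}) ψ(s), such that u solves Σ_{i=1}^N ∂_i(g(q²) ∂_i u) = N in Ω with q = |∇u|, and satisfies u = 0 and |∇u| = q₀ on the outer sphere |x| = r₀, and u = −c₁ and ∇u = 0 on the inner sphere |x| = r₁. -/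
open Set Filter

noncomputable section

/-- `G(ξ) = g(ξ) + 2ξ g'(ξ)`, from (1.2). -/
def Gfun (g : ℝ → ℝ) (ξ : ℝ) : ℝ := g ξ + 2 * ξ * deriv g ξ

/-- Conditions (2.4) on `g`. -/
def Cond24 (g : ℝ → ℝ) : Prop :=
  ContDiffOn ℝ (⊤ : ℕ∞) g (Ioi 0) ∧ (∀ ξ > (0:ℝ), 0 < g ξ) ∧
  Tendsto (fun ξ : ℝ => g (ξ ^ 2) * ξ) (nhdsWithin 0 (Ioi 0)) (nhds 0) ∧
  Tendsto (fun ξ : ℝ => g (ξ ^ 2) * ξ) atTop atTop ∧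
  (∀ ξ > (0:ℝ), 0 < Gfun g ξ)

/-- The `i`-th standard basis vector of `ℝ^N`. -/
def eb (N : ℕ) (i : Fin N) : EuclideanSpace ℝ (Fin N) := EuclideanSpace.single i 1

/-- A continuous strictly increasing function on a half-line which tends to `∞` agrees there with
an order automorphism of `ℝ`. -/
theorem exists_orderIso_eqOn_Ici {f : ℝ → ℝ} {a : ℝ} (hmono : StrictMonoOn f (Ici a))
    (hcont : ContinuousOn f (Ici a)) (htop : Tendsto f atTop atTop) :
    ∃ e : ℝ ≃o ℝ, EqOn e f (Ici a) := by
  set F : ℝ → ℝ := fun x => f (max x a) + min (x - a) 0 with hF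
  have hFIci : ∀ x, a ≤ x → F x = f x := fun x hx => by
    simp [hF, max_eq_left hx, min_eq_right (sub_nonneg.2 hx)]
  have hFIic : ∀ x, x ≤ a → F x = f a + (x - a) := fun x hx => by
    simp [hF, max_eq_right hx, min_eq_left (sub_nonpos.2 hx)]
  have hFmono : StrictMono F := by
    intro x y hxy
    rcases le_total a x with hx | hx
    · rw [hFIci x hx, hFIci y (hx.trans hxy.le)]
      exact hmono hx (hx.trans hxy.le) hxy
    · rw [hFIic x hx]
      rcases le_total a y with hy | hy
      · rw [hFIci y hy]
        rcases hy.eq_or_lt with rfl | hy'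
        · linarith
        · linarith [hmono self_mem_Ici hy hy']
      · rw [hFIic y hy]
        linarith
  have hFcont : Continuous F := by
    refine Continuous.add ?_ (by fun_prop)
    exact hcont.comp_continuous (by fun_prop) fun x => le_max_right x a
  have hFtop : Tendsto F atTop atTop :=
    htop.congr' ((eventually_ge_atTop a).mono fun x hx => (hFIci x hx).symm)
  have hFbot : Tendsto F atBot atBot := by
    have h : Tendsto (fun x : ℝ => (f a - a) + x) atBot atBot :=
      tendsto_atBot_add_const_left _ _ tendsto_id
    exact h.congr' ((eventually_le_atBot a).mono fun x hx => by rw [hFIic x hx]; ring)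
  refine ⟨hFmono.orderIsoOfSurjective F (hFcont.surjective hFtop hFbot), fun x hx => ?_⟩
  rw [StrictMono.coe_orderIsoOfSurjective]
  exact hFIci x hx

/-- The equality case of Young's inequality for an order automorphism of the real line. -/
theorem OrderIso.integral_symm_add_integral (e : ℝ ≃o ℝ) (a b : ℝ) :
    (∫ t in e a..e b, e.symm t) + ∫ s in a..b, e s = b * e b - a * e a := by
  have hi : ∀ x y, IntervalIntegrable e MeasureTheory.volume x y :=
    fun x y => e.continuous.intervalIntegrable x y
  have hi' : ∀ x y, IntervalIntegrable e.symm MeasureTheory.volume x y :=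
    fun x y => e.symm.continuous.intervalIntegrable x y
  set D : ℝ → ℝ := fun x => (∫ t in e a..e x, e.symm t) + (∫ s in a..x, e s) - x * e x with hD
  have hbound : ∀ x y, ‖D y - D x‖ ≤ 2 * (|y - x| * |e y - e x|) := by
    intro x y
    have h₁ : D y - D x = (∫ t in e x..e y, (e.symm t - x)) + ∫ s in x..y, (e s - e y) := by
      rw [intervalIntegral.integral_sub (hi' _ _) intervalIntegrable_const,
        intervalIntegral.integral_sub (hi _ _) intervalIntegrable_const,
        intervalIntegral.integral_const, intervalIntegral.integral_const,
        ← intervalIntegral.integral_interval_sub_left (hi' (e a) (e y)) (hi' (e a) (e x)),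
        ← intervalIntegral.integral_interval_sub_left (hi a y) (hi a x)]
      simp only [hD, smul_eq_mul]
      ring
    have h₂ : ‖∫ t in e x..e y, (e.symm t - x)‖ ≤ |y - x| * |e y - e x| := by
      refine intervalIntegral.norm_integral_le_of_norm_le_const fun t ht => ?_
      have hmem : e.symm t ∈ uIcc x y := by
        rcases mem_uIcc.1 (uIoc_subset_uIcc ht) with h | h
        · exact mem_uIcc.2 (.inl ⟨e.le_symm_apply.2 h.1, e.symm_apply_le.2 h.2⟩)
        · exact mem_uIcc.2 (.inr ⟨e.le_symm_apply.2 h.1, e.symm_apply_le.2 h.2⟩)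
      simpa [Real.norm_eq_abs] using abs_sub_left_of_mem_uIcc hmem
    have h₃ : ‖∫ s in x..y, (e s - e y)‖ ≤ |e y - e x| * |y - x| := by
      refine intervalIntegral.norm_integral_le_of_norm_le_const fun s hs => ?_
      have hmem : e s ∈ uIcc (e x) (e y) := by
        rcases mem_uIcc.1 (uIoc_subset_uIcc hs) with h | h
        · exact mem_uIcc.2 (.inl ⟨e.monotone h.1, e.monotone h.2⟩)
        · exact mem_uIcc.2 (.inr ⟨e.monotone h.1, e.monotone h.2⟩)
      rw [Real.norm_eq_abs, abs_sub_comm]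
      exact abs_sub_right_of_mem_uIcc hmem
    rw [h₁]
    exact (norm_add_le _ _).trans (by linarith [mul_comm |e y - e x| |y - x|])
  have hderiv : ∀ x, HasDerivAt D 0 x := by
    intro x
    rw [hasDerivAt_iff_isLittleO]
    have h₁ : (fun y => e y - e x) =o[nhds x] (fun _ => (1 : ℝ)) := by
      rw [Asymptotics.isLittleO_one_iff]
      simpa using (e.continuous.tendsto x).sub_const (e x)
    have h₂ : (fun y => (y - x) * (e y - e x)) =o[nhds x] (fun y => (y - x) * 1) :=
      (Asymptotics.isBigO_refl _ _).mul_isLittleO h₁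
    simp only [mul_one] at h₂
    refine Asymptotics.IsBigO.trans_isLittleO (Asymptotics.IsBigO.of_bound 2 ?_) h₂
    refine Eventually.of_forall fun y => ?_
    simpa [abs_mul] using hbound x y
  have hconst : D b = D a :=
    is_const_of_deriv_eq_zero (fun x => (hderiv x).differentiableAt)
      (fun x => (hderiv x).deriv) b a
  simp only [hD, intervalIntegral.integral_same] at hconst
  linarith

/-- Integration by parts for a function whose derivative is nonnegative but possibly unbounded
near `0`. -/
theorem integral_id_mul_deriv_eq_integral_sub {F F' : ℝ → ℝ} {q : ℝ} (hq : 0 ≤ q)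
    (hF : Continuous F) (hderiv : ∀ s, 0 < s → HasDerivAt F (F' s) s)
    (hpos : ∀ s, 0 < s → 0 ≤ F' s) :
    ∫ s in (0 : ℝ)..q, s * F' s = ∫ s in (0 : ℝ)..q, (F q - F s) := by
  set W : ℝ → ℝ := fun s => s * F s - ∫ x in (0 : ℝ)..s, F x with hW
  have hint : ∀ s, HasDerivAt (fun s => ∫ x in (0 : ℝ)..s, F x) (F s) s := fun s =>
    intervalIntegral.integral_hasDerivAt_right (hF.intervalIntegrable _ _)
      (hF.stronglyMeasurableAtFilter _ _) hF.continuousAt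
  have hWcont : Continuous W :=
    (continuous_id.mul hF).sub
      (continuous_iff_continuousAt.2 fun s => (hint s).continuousAt)
  have hWderiv : ∀ s, 0 < s → HasDerivAt W (s * F' s) s := fun s hs =>
    (((hasDerivAt_id s).mul (hderiv s hs)).sub (hint s)).congr_deriv (by simp)
  have hii : IntervalIntegrable (fun s => s * F' s) MeasureTheory.volume 0 q := by
    rw [intervalIntegrable_iff_integrableOn_Ioc_of_le hq]
    exact intervalIntegral.integrableOn_deriv_of_nonneg hWcont.continuousOn
      (fun s hs => hWderiv s hs.1) fun s hs => mul_nonneg hs.1.le (hpos s hs.1)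
  rw [intervalIntegral.integral_eq_sub_of_hasDerivAt_of_le hq hWcont.continuousOn
    (fun s hs => hWderiv s hs.1) hii,
    intervalIntegral.integral_sub intervalIntegrable_const (hF.intervalIntegrable _ _)]
  simp [hW]

/-- The normalised radial flux `τ ↦ τ - τ⁻ⁿ` of the annulus with inner radius `1` in dimension
`n + 1`. -/
def radialFlux (n : ℕ) (τ : ℝ) : ℝ := τ - (τ ^ n)⁻¹

@[simp]
theorem radialFlux_one (n : ℕ) : radialFlux n 1 = 0 := by simp [radialFlux]

theorem sub_le_radialFlux_sub (n : ℕ) {σ τ : ℝ} (hσ : 1 ≤ σ) (hστ : σ ≤ τ) :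
    τ - σ ≤ radialFlux n τ - radialFlux n σ := by
  have h : (τ ^ n)⁻¹ ≤ (σ ^ n)⁻¹ := by gcongr
  simp only [radialFlux]
  linarith

theorem radialFlux_le (n : ℕ) {τ : ℝ} (hτ : 1 ≤ τ) : radialFlux n τ ≤ (n + 1) * (τ - 1) := by
  have hτ0 : 0 < τ := by linarith
  have h := one_add_mul_le_pow (a := τ⁻¹ - 1) (by linarith [inv_pos.2 hτ0]) n
  have h' : 1 - τ⁻¹ ≤ τ - 1 := by
    have : τ * τ⁻¹ = 1 := mul_inv_cancel₀ hτ0.ne'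
    nlinarith [inv_pos.2 hτ0, sq_nonneg (τ - 1)]
  have h'' : (n : ℝ) * (1 - τ⁻¹) ≤ n * (τ - 1) := by gcongr
  rw [add_sub_cancel, inv_pow] at h
  simp only [radialFlux]
  linarith

theorem le_radialFlux (n : ℕ) {τ : ℝ} (hτ : 1 ≤ τ) :
    (τ - 1) * (1 + n / τ ^ n) ≤ radialFlux n τ := by
  have hτ0 : 0 < τ ^ n := by positivity
  have h := one_add_mul_le_pow (a := τ - 1) (by linarith) n
  rw [add_sub_cancel] at h
  have h' : (τ - 1) * (n / τ ^ n) ≤ 1 - (τ ^ n)⁻¹ := by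
    have : 1 - (τ ^ n)⁻¹ = (τ ^ n - 1) / τ ^ n := by field_simp
    rw [this, ← mul_div_assoc]
    gcongr
    linarith
  simp only [radialFlux]
  linarith

theorem exists_orderIso_radialFlux (n : ℕ) : ∃ e : ℝ ≃o ℝ, EqOn e (radialFlux n) (Ici 1) := by
  refine exists_orderIso_eqOn_Ici (fun σ hσ τ _ hστ => ?_) ?_ ?_
  · linarith [sub_le_radialFlux_sub n hσ hστ.le]
  · refine continuousOn_id.sub (ContinuousOn.inv₀ (by fun_prop) fun τ hτ => ?_)
    have : (0 : ℝ) < τ := lt_of_lt_of_le one_pos hτ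
    positivity
  · refine tendsto_atTop_mono' atTop ?_ (tendsto_atTop_add_const_right atTop (-1) tendsto_id)
    filter_upwards [eventually_ge_atTop 1] with τ hτ
    have := sub_le_radialFlux_sub n le_rfl hτ
    simpa [sub_eq_add_neg] using this

section InverseFlux

variable {n : ℕ} {e : ℝ ≃o ℝ}

theorem symm_radialFlux_zero (he : EqOn e (radialFlux n) (Ici 1)) : e.symm 0 = 1 := by
  rw [OrderIso.symm_apply_eq, he self_mem_Ici, radialFlux_one]

theorem one_le_symm_radialFlux (he : EqOn e (radialFlux n) (Ici 1)) {y : ℝ} (hy : 0 ≤ y) :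
    1 ≤ e.symm y :=
  (symm_radialFlux_zero he).symm.le.trans (e.symm.monotone hy)

theorem radialFlux_symm (he : EqOn e (radialFlux n) (Ici 1)) {y : ℝ} (hy : 0 ≤ y) :
    radialFlux n (e.symm y) = y := by
  rw [← he (one_le_symm_radialFlux he hy), e.apply_symm_apply]

theorem symm_radialFlux_sub_le (he : EqOn e (radialFlux n) (Ici 1)) {x y : ℝ} (hx : 0 ≤ x)
    (hxy : x ≤ y) : e.symm y - e.symm x ≤ y - x := by
  have h := sub_le_radialFlux_sub n (one_le_symm_radialFlux he hx) (e.symm.monotone hxy)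
  rwa [radialFlux_symm he hx, radialFlux_symm he (hx.trans hxy)] at h

theorem tendsto_mul_symm_radialFlux_nhdsGT_zero (he : EqOn e (radialFlux n) (Ici 1)) {y : ℝ}
    (hy : 0 ≤ y) :
    Tendsto (fun r : ℝ => r * e.symm (y / r)) (nhdsWithin 0 (Ioi 0)) (nhds y) := by
  have hlim : Tendsto (fun r : ℝ => y + r) (nhdsWithin 0 (Ioi 0)) (nhds y) := by
    have : Tendsto (fun r : ℝ => y + r) (nhds 0) (nhds (y + 0)) :=
      (continuous_const.add continuous_id).tendsto 0
    rw [add_zero] at this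
    exact this.mono_left nhdsWithin_le_nhds
  refine tendsto_of_tendsto_of_tendsto_of_le_of_le' tendsto_const_nhds hlim ?_ ?_
  · filter_upwards [self_mem_nhdsWithin] with r (hr : 0 < r)
    have hyr : 0 ≤ y / r := by positivity
    have h₁ : y / r ≤ e.symm (y / r) := by
      have h := radialFlux_symm he hyr
      have : 0 ≤ ((e.symm (y / r)) ^ n)⁻¹ := by
        have := one_le_symm_radialFlux he hyr
        positivity
      simp only [radialFlux] at h
      linarith
    rwa [div_le_iff₀' hr] at h₁
  · filter_upwards [self_mem_nhdsWithin] with r (hr : 0 < r)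
    have hyr : 0 ≤ y / r := by positivity
    have h := symm_radialFlux_sub_le he le_rfl hyr
    rw [symm_radialFlux_zero he] at h
    calc r * e.symm (y / r) ≤ r * (y / r + 1) := by gcongr; linarith
      _ = y + r := by field_simp

theorem tendsto_mul_symm_radialFlux_sub_one_atTop (he : EqOn e (radialFlux n) (Ici 1)) {y : ℝ}
    (hy : 0 ≤ y) :
    Tendsto (fun r : ℝ => r * (e.symm (y / r) - 1)) atTop (nhds (y / (n + 1))) := by
  have hk : Tendsto (fun r : ℝ => e.symm (y / r)) atTop (nhds 1) := by
    have h₀ : Tendsto (fun r : ℝ => y / r) atTop (nhds 0) := tendsto_const_nhds.div_atTop tendsto_id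
    have h := (e.symm.continuous.tendsto 0).comp h₀
    rwa [symm_radialFlux_zero he] at h
  have hlim : Tendsto (fun r : ℝ => y / (1 + n / e.symm (y / r) ^ n)) atTop
      (nhds (y / (n + 1))) := by
    have hone : Tendsto (fun r : ℝ => 1 + (n : ℝ) / e.symm (y / r) ^ n) atTop
        (nhds (1 + n / 1 ^ n)) :=
      tendsto_const_nhds.add (tendsto_const_nhds.div (hk.pow n) (by simp))
    have h := (tendsto_const_nhds (x := y)).div hone (by rw [one_pow, div_one]; positivity)
    rwa [one_pow, div_one, add_comm (1 : ℝ)] at h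
  refine tendsto_of_tendsto_of_tendsto_of_le_of_le' tendsto_const_nhds hlim ?_ ?_
  · filter_upwards [eventually_gt_atTop 0] with r hr
    have hyr : 0 ≤ y / r := by positivity
    have h := radialFlux_le n (one_le_symm_radialFlux he hyr)
    rw [radialFlux_symm he hyr, div_le_iff₀' hr] at h
    rw [div_le_iff₀' (by positivity)]
    linarith
  · filter_upwards [eventually_gt_atTop 0] with r hr
    have hyr : 0 ≤ y / r := by positivity
    have hk1 := one_le_symm_radialFlux he hyr
    have h := le_radialFlux n hk1
    rw [radialFlux_symm he hyr, le_div_iff₀' hr] at h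
    rw [le_div_iff₀ (by positivity)]
    linarith

theorem exists_integral_mul_symm_radialFlux_eq (he : EqOn e (radialFlux n) (Ici 1))
    {F : ℝ → ℝ} (hF : Continuous F) {q c : ℝ} (hq : 0 ≤ q) (hF0 : ∀ s ∈ Icc 0 q, 0 ≤ F s)
    (hFq : ∀ s ∈ Icc 0 q, F s ≤ F q)
    (hlo : (∫ s in (0 : ℝ)..q, (F q - F s)) / (n + 1) < c)
    (hhi : c < ∫ s in (0 : ℝ)..q, (F q - F s)) :
    ∃ r : ℝ, 0 < r ∧ ∫ s in (0 : ℝ)..q, (r * e.symm (F q / r) - r * e.symm (F s / r)) = c := by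
  set C : ℝ → ℝ := fun r =>
    ∫ s in (0 : ℝ)..q, (r * e.symm (F q / r) - r * e.symm (F s / r))
  have hk := e.symm.continuous
  have hmem : ∀ {s : ℝ}, s ∈ uIoc 0 q → s ∈ Icc 0 q := fun hs => by
    rw [uIoc_of_le hq] at hs
    exact Ioc_subset_Icc_self hs
  have hq' : q ∈ Icc 0 q := right_mem_Icc.2 hq
  have hlim : ∀ (l : Filter ℝ) [l.IsCountablyGenerated] (f : ℝ → ℝ), (∀ᶠ r in l, 0 < r) →
      (∀ s ∈ Icc 0 q, Tendsto (fun r => r * e.symm (F q / r) - r * e.symm (F s / r)) l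
        (nhds (f s))) →
      Tendsto C l (nhds (∫ s in (0 : ℝ)..q, f s)) := by
    intro l _ f hl hf
    refine intervalIntegral.tendsto_integral_filter_of_dominated_convergence
      (fun s => F q - F s) ?_ ?_ ?_ ?_
    · exact Eventually.of_forall fun r => Continuous.aestronglyMeasurable (by fun_prop)
    · filter_upwards [hl] with r hr
      refine Eventually.of_forall fun s hs => ?_
      have hs' := hmem hs
      have hle : F s / r ≤ F q / r := by
        have := hFq s hs'
        gcongr
      have h₀ := e.symm.monotone hle
      have h₁ := symm_radialFlux_sub_le he (div_nonneg (hF0 s hs') hr.le) hle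
      rw [← mul_sub, Real.norm_of_nonneg (mul_nonneg hr.le (sub_nonneg.2 h₀))]
      calc r * (e.symm (F q / r) - e.symm (F s / r)) ≤ r * (F q / r - F s / r) := by gcongr
        _ = F q - F s := by field_simp
    · exact Continuous.intervalIntegrable (by fun_prop) _ _
    · exact Eventually.of_forall fun s hs => hf s (hmem hs)
  have hcont : ContinuousOn C (Ioi 0) := by
    refine continuousOn_of_forall_continuousAt fun r (hr : 0 < r) => ?_
    refine hlim (nhds r) _ (lt_mem_nhds hr) fun s _ => ?_
    have hdiv : ∀ y : ℝ, Tendsto (fun r => r * e.symm (y / r)) (nhds r)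
        (nhds (r * e.symm (y / r))) := fun y =>
      tendsto_id.mul ((hk.tendsto _).comp (tendsto_const_nhds.div tendsto_id hr.ne'))
    exact (hdiv _).sub (hdiv _)
  have hzero : Tendsto C (nhdsWithin 0 (Ioi 0)) (nhds (∫ s in (0 : ℝ)..q, (F q - F s))) :=
    hlim _ _ self_mem_nhdsWithin fun s hs =>
      (tendsto_mul_symm_radialFlux_nhdsGT_zero he (hF0 q hq')).sub
        (tendsto_mul_symm_radialFlux_nhdsGT_zero he (hF0 s hs))
  have htop : Tendsto C atTop (nhds ((∫ s in (0 : ℝ)..q, (F q - F s)) / (n + 1))) := by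
    rw [← intervalIntegral.integral_div]
    refine hlim _ _ (eventually_gt_atTop 0) fun s hs => ?_
    have h := (tendsto_mul_symm_radialFlux_sub_one_atTop he (hF0 q hq')).sub
      (tendsto_mul_symm_radialFlux_sub_one_atTop he (hF0 s hs))
    rw [← sub_div] at h
    exact h.congr fun r => by ring
  obtain ⟨a, hca, ha⟩ := ((hzero.eventually_const_lt hhi).and self_mem_nhdsWithin).exists
  obtain ⟨b, hcb, hb⟩ := ((htop.eventually_lt_const hlo).and (eventually_gt_atTop 0)).exists
  exact isPreconnected_Ioi.intermediate_value hb ha hcont ⟨hcb.le, hca.le⟩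

end InverseFlux

section Radial

variable {E : Type*} [NormedAddCommGroup E] [InnerProductSpace ℝ E]

theorem hasFDerivAt_norm_of_ne_zero {x : E} (hx : x ≠ 0) :
    HasFDerivAt (fun y : E => ‖y‖) (‖x‖⁻¹ • innerSL ℝ x) x := by
  have hx' : ‖x‖ ≠ 0 := norm_ne_zero_iff.2 hx
  have h := (hasStrictFDerivAt_norm_sq x).hasFDerivAt.sqrt (pow_ne_zero 2 hx')
  simp only [Real.sqrt_sq (norm_nonneg _)] at h
  refine h.congr_fderiv ?_
  ext v
  simp
  field_simp

theorem hasGradientAt_integral_norm [CompleteSpace E] {φ : ℝ → ℝ} (hφ : Continuous φ) (a : ℝ)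
    {x : E} (hx : x ≠ 0) :
    HasGradientAt (fun y : E => ∫ t in a..‖y‖, φ t) ((φ ‖x‖ / ‖x‖) • x) x := by
  rw [hasGradientAt_iff_hasFDerivAt]
  have h : HasDerivAt (fun s => ∫ t in a..s, φ t) (φ ‖x‖) ‖x‖ :=
    intervalIntegral.integral_hasDerivAt_right (hφ.intervalIntegrable _ _)
      (hφ.stronglyMeasurableAtFilter _ _) hφ.continuousAt
  refine (h.comp_hasFDerivAt x (hasFDerivAt_norm_of_ne_zero hx)).congr_fderiv ?_
  ext v
  simp [div_eq_mul_inv, mul_assoc]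

end Radial

theorem sum_fderiv_radial {N : ℕ} {m : ℝ → ℝ} {m' : ℝ} {x : EuclideanSpace ℝ (Fin N)}
    (hx : x ≠ 0) (hm : HasDerivAt m m' ‖x‖) :
    ∑ i, fderiv ℝ (fun y : EuclideanSpace ℝ (Fin N) => m ‖y‖ * y i) x (eb N i) =
      N * m ‖x‖ + m' * ‖x‖ := by
  have hterm : ∀ i, fderiv ℝ (fun y : EuclideanSpace ℝ (Fin N) => m ‖y‖ * y i) x (eb N i) =
      m ‖x‖ + m' * ‖x‖⁻¹ * (x i) ^ 2 := by
    intro i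
    have h₁ := hm.comp_hasFDerivAt x (hasFDerivAt_norm_of_ne_zero hx)
    have h₂ : HasFDerivAt (fun y : EuclideanSpace ℝ (Fin N) => y i)
        (EuclideanSpace.proj i : EuclideanSpace ℝ (Fin N) →L[ℝ] ℝ) x :=
      (EuclideanSpace.proj i : EuclideanSpace ℝ (Fin N) →L[ℝ] ℝ).hasFDerivAt
    have h := (h₁.mul h₂).fderiv
    simp only [Pi.mul_def, Function.comp_def] at h
    rw [h]
    simp [eb, EuclideanSpace.inner_single_right]
    ring
  have hx' : ‖x‖ ≠ 0 := norm_ne_zero_iff.2 hx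
  rw [Finset.sum_congr rfl fun i _ => hterm i, Finset.sum_add_distrib, ← Finset.mul_sum,
    ← EuclideanSpace.real_norm_sq_eq]
  simp
  field_simp

theorem hasDerivAt_mul_self_of_cond24 {g : ℝ → ℝ} (hg : Cond24 g) {s : ℝ} (hs : 0 < s) :
    HasDerivAt (fun s => g (s ^ 2) * s) (Gfun g (s ^ 2)) s := by
  have hs2 : 0 < s ^ 2 := by positivity
  have h₁ : HasDerivAt g (deriv g (s ^ 2)) (s ^ 2) :=
    ((hg.1.differentiableOn (by simp)).differentiableAt (Ioi_mem_nhds hs2)).hasDerivAt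
  have h₂ : HasDerivAt (fun s : ℝ => g (s ^ 2)) (deriv g (s ^ 2) * (2 * s)) s :=
    (HasDerivAt.comp (h := fun s : ℝ => s ^ 2) s h₁ (hasDerivAt_pow 2 s)).congr_deriv (by simp)
  refine (h₂.mul (hasDerivAt_id' s)).congr_deriv ?_
  simp only [Gfun]
  ring

theorem Cond24.exists_orderIso {g : ℝ → ℝ} (hg : Cond24 g) :
    ∃ e : ℝ ≃o ℝ, EqOn e (fun s => g (s ^ 2) * s) (Ici 0) := by
  have hcont : ContinuousOn (fun s => g (s ^ 2) * s) (Ici 0) := by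
    intro s hs
    rcases (mem_Ici.1 hs).eq_or_lt with rfl | hs
    · rw [← continuousWithinAt_Ioi_iff_Ici, ContinuousWithinAt, mul_zero]
      exact hg.2.2.1
    · exact (hasDerivAt_mul_self_of_cond24 hg hs).continuousAt.continuousWithinAt
  refine exists_orderIso_eqOn_Ici (strictMonoOn_of_deriv_pos (convex_Ici 0) hcont ?_) hcont
    hg.2.2.2.1
  intro s hs
  rw [interior_Ici, mem_Ioi] at hs
  rw [(hasDerivAt_mul_self_of_cond24 hg hs).deriv]
  exact hg.2.2.2.2 _ (by positivity)

/-- A radial profile `φ` with flux `g(φ²)φ = (1 - r^N t⁻ᴺ) t` gives a solution of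
`div (g(|∇u|²)∇u) = N`. -/
theorem sum_fderiv_flux_eq {N : ℕ} {g φ : ℝ → ℝ} {r a : ℝ} (hφ : Continuous φ)
    (hr : 0 < r) (hφ0 : ∀ t, r ≤ t → 0 ≤ φ t)
    (hflux : ∀ t, r ≤ t → g (φ t ^ 2) * φ t = (1 - r ^ N * t ^ (-(N : ℤ))) * t)
    {x : EuclideanSpace ℝ (Fin N)} (hx : r < ‖x‖) {u : EuclideanSpace ℝ (Fin N) → ℝ}
    (hu : ∀ y, u y = ∫ t in a..‖y‖, φ t) :
    ∑ i, fderiv ℝ (fun y => g (‖gradient u y‖ ^ 2) * fderiv ℝ u y (eb N i)) x (eb N i) = N := by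
  obtain rfl : u = fun y => ∫ t in a..‖y‖, φ t := funext hu
  have hx0 : 0 < ‖x‖ := hr.trans hx
  have heq : ∀ i, (fun y => g (‖gradient (fun y => ∫ t in a..‖y‖, φ t) y‖ ^ 2) *
      fderiv ℝ (fun y : EuclideanSpace ℝ (Fin N) => ∫ t in a..‖y‖, φ t) y (eb N i)) =ᶠ[nhds x]
      fun y => (1 - r ^ N * ‖y‖ ^ (-(N : ℤ))) * y i := by
    intro i
    filter_upwards [continuous_norm.continuousAt.eventually_const_lt hx] with y hy
    have hy0 : 0 < ‖y‖ := hr.trans hy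
    have hgrad := hasGradientAt_integral_norm hφ a (norm_pos_iff.1 hy0)
    have hnorm : ‖(φ ‖y‖ / ‖y‖) • y‖ = φ ‖y‖ := by
      rw [norm_smul, Real.norm_of_nonneg (div_nonneg (hφ0 _ hy.le) hy0.le),
        div_mul_cancel₀ _ hy0.ne']
    have hf := hflux _ hy.le
    rw [hgrad.gradient, hgrad.hasFDerivAt.fderiv, hnorm]
    simp only [InnerProductSpace.toDual_apply_apply, eb, EuclideanSpace.inner_single_right,
      PiLp.smul_apply, smul_eq_mul, one_mul, conj_trivial]
    rw [← mul_assoc, ← mul_div_assoc, hf, mul_div_assoc, div_self hy0.ne', mul_one]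
  have hm : HasDerivAt (fun t : ℝ => 1 - r ^ N * t ^ (-(N : ℤ)))
      (-(r ^ N * ((-(N : ℤ) : ℤ) * ‖x‖ ^ (-(N : ℤ) - 1)))) ‖x‖ :=
    ((hasDerivAt_zpow _ _ (.inl hx0.ne')).const_mul _).const_sub 1
  rw [Finset.sum_congr rfl fun i _ => by rw [(heq i).fderiv_eq],
    sum_fderiv_radial (norm_pos_iff.1 hx0) hm, zpow_sub_one₀ hx0.ne']
  push_cast
  field_simp
  ring

/-- The implicitly defined function `ψ` of the annulus with inner radius `r`, where `F(s)` stands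
for `g(s²)s`. -/
theorem exists_orderIso_implicit {n : ℕ} {e F : ℝ ≃o ℝ} (he : EqOn e (radialFlux n) (Ici 1))
    (hF0 : F 0 = 0) {r : ℝ} (hr : 0 < r) :
    ∃ ψ : ℝ ≃o ℝ, (∀ s, ψ s = r * e.symm (F s / r)) ∧ ψ 0 = r ∧
      ∀ s, 0 ≤ s → F s = (1 - r ^ (n + 1) * ψ s ^ (-((n + 1 : ℕ) : ℤ))) * ψ s := by
  set M := OrderIso.mulLeft₀ r hr
  have hψ : ∀ s, (F.trans (M.symm.trans (e.symm.trans M))) s = r * e.symm (F s / r) := by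
    intro s
    have hM : M.symm (F s) = F s / r := by
      rw [OrderIso.symm_apply_eq]
      exact (mul_div_cancel₀ _ hr.ne').symm
    simp only [OrderIso.trans_apply, hM]
    rfl
  refine ⟨_, hψ, by rw [hψ, hF0, zero_div, symm_radialFlux_zero he, mul_one], fun s hs => ?_⟩
  rw [hψ]
  have hFs : 0 ≤ F s / r := div_nonneg (hF0.symm.le.trans (F.monotone hs)) hr.le
  have h := radialFlux_symm he hFs
  have hτ : 0 < e.symm (F s / r) := one_pos.trans_le (one_le_symm_radialFlux he hFs)
  set τ := e.symm (F s / r)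
  rw [radialFlux, eq_div_iff hr.ne'] at h
  rw [← h, zpow_neg, zpow_natCast, mul_pow]
  field_simp
  ring

/-- Sufficiency part of the paper's Theorem 3.1: if `q₀, c₁ > 0` satisfy the
inequalities (3.5), then the overdetermined problem (3.1)–(3.3) is solvable on a
spherical annulus `{r₁ < |x| < r₀}`, with `r₀` determined by (3.24), by the radial
function `u(x) = ∫_{r₀}^{|x|} φ(t) dt`, where `φ` is the inverse of the strictly
increasing function `ψ` defined implicitly by `g(s²)s = (1 − r₁^N ψ^{−N}) ψ` (3.25). -/
theorem stmt12 (N : ℕ) (hN : 2 ≤ N) (g : ℝ → ℝ) (hg : Cond24 g)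
    (q₀ c₁ : ℝ) (hq₀ : 0 < q₀) (hc₁ : 0 < c₁)
    (hlo : (1 / N : ℝ) * (∫ s in (0:ℝ)..q₀, s * Gfun g (s ^ 2)) < c₁)
    (hhi : c₁ < ∫ s in (0:ℝ)..q₀, s * Gfun g (s ^ 2)) :
    ∃ r₁ r₀ : ℝ, 0 < r₁ ∧ r₁ < r₀ ∧
      g (q₀ ^ 2) * q₀ * r₀ ^ (N - 1) = r₀ ^ N - r₁ ^ N ∧
      ∃ ψ φ : ℝ → ℝ,
        StrictMonoOn ψ (Ici 0) ∧ ψ 0 = r₁ ∧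
        (∀ s ≥ (0:ℝ), r₁ ≤ ψ s ∧
          g (s ^ 2) * s = (1 - r₁ ^ N * (ψ s) ^ (-(N : ℤ))) * ψ s) ∧
        (∀ s ≥ (0:ℝ), φ (ψ s) = s) ∧ (∀ t ≥ r₁, ψ (φ t) = t) ∧
        ∃ u : EuclideanSpace ℝ (Fin N) → ℝ,
          (∀ x : EuclideanSpace ℝ (Fin N), u x = ∫ t in r₀..‖x‖, φ t) ∧
          (∀ x : EuclideanSpace ℝ (Fin N), r₁ < ‖x‖ → ‖x‖ < r₀ →
            ∑ i, fderiv ℝ (fun y => g (‖gradient u y‖ ^ 2) * fderiv ℝ u y (eb N i))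
              x (eb N i) = (N : ℝ)) ∧
          (∀ x : EuclideanSpace ℝ (Fin N), ‖x‖ = r₀ →
            u x = 0 ∧ ‖gradient u x‖ = q₀) ∧
          (∀ x : EuclideanSpace ℝ (Fin N), ‖x‖ = r₁ →
            u x = -c₁ ∧ gradient u x = 0) := by
  obtain ⟨n, rfl⟩ : ∃ n, N = n + 1 := ⟨N - 1, by lia⟩
  obtain ⟨F, hF⟩ := hg.exists_orderIso
  obtain ⟨e, he⟩ := exists_orderIso_radialFlux n
  have hF0 : F 0 = 0 := by simp [hF self_mem_Ici]
  have hFderiv : ∀ s, 0 < s → HasDerivAt F (Gfun g (s ^ 2)) s := fun s hs =>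
    (hasDerivAt_mul_self_of_cond24 hg hs).congr_of_eventuallyEq
      (hF.eventuallyEq_of_mem (Ici_mem_nhds hs))
  have hI : ∫ s in (0 : ℝ)..q₀, s * Gfun g (s ^ 2) = ∫ s in (0 : ℝ)..q₀, (F q₀ - F s) :=
    integral_id_mul_deriv_eq_integral_sub (F' := fun s => Gfun g (s ^ 2)) hq₀.le F.continuous
      hFderiv fun s hs => (hg.2.2.2.2 _ (by positivity)).le
  rw [hI] at hlo hhi
  obtain ⟨r, hr, hrc⟩ := exists_integral_mul_symm_radialFlux_eq he F.continuous hq₀.le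
    (fun s hs => hF0.symm.le.trans (F.monotone hs.1)) (fun s hs => F.monotone hs.2)
    (c := c₁) (by rw [div_eq_inv_mul]; simpa using hlo) hhi
  obtain ⟨ψ, hψ, hψ0, hψF⟩ := exists_orderIso_implicit he hF0 hr
  simp only [← hψ] at hrc
  have hψeq : ∀ s ≥ (0 : ℝ), g (s ^ 2) * s =
      (1 - r ^ (n + 1) * ψ s ^ (-((n + 1 : ℕ) : ℤ))) * ψ s := fun s hs => by
    rw [← hψF s hs, hF hs]
  have hψr : ∀ s ≥ (0 : ℝ), r ≤ ψ s := fun s hs => hψ0.symm.le.trans (ψ.monotone hs)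
  have hφr : ψ.symm r = 0 := by rw [← hψ0, ψ.symm_apply_apply]
  have hφ0 : ∀ t, r ≤ t → 0 ≤ ψ.symm t := fun t ht => hφr.symm.le.trans (ψ.symm.monotone ht)
  have hφcont := ψ.symm.continuous
  have hr₀ : r < ψ q₀ := hψ0.symm.le.trans_lt (ψ.strictMono hq₀)
  have hyoung : ∫ t in r..ψ q₀, ψ.symm t = c₁ := by
    have h := ψ.integral_symm_add_integral 0 q₀
    rw [intervalIntegral.integral_sub intervalIntegrable_const
      (ψ.continuous.intervalIntegrable _ _)] at hrc
    simp only [intervalIntegral.integral_const, sub_zero, smul_eq_mul] at hrc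
    rw [hψ0] at h
    linarith
  refine ⟨r, ψ q₀, hr, hr₀, ?_, ψ, ψ.symm, ψ.strictMono.strictMonoOn _, hψ0,
    fun s hs => ⟨hψr s hs, hψeq s hs⟩, fun s _ => ψ.symm_apply_apply s,
    fun t _ => ψ.apply_symm_apply t, fun x => ∫ t in ψ q₀..‖x‖, ψ.symm t, fun x => rfl,
    fun x hx _ => ?_, fun x hx => ⟨?_, ?_⟩, fun x hx => ⟨?_, ?_⟩⟩
  · have hpos := hr.trans hr₀
    rw [hψeq q₀ hq₀.le, zpow_neg, zpow_natCast, Nat.add_sub_cancel]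
    field_simp
    ring
  · refine sum_fderiv_flux_eq hφcont hr hφ0 (fun t ht => ?_) hx fun y => rfl
    rw [hψeq _ (hφ0 t ht), ψ.apply_symm_apply]
  · simp [hx]
  · have hpos : 0 < ‖x‖ := hx ▸ hr.trans hr₀
    rw [(hasGradientAt_integral_norm hφcont _ (norm_pos_iff.1 hpos)).gradient, norm_smul, hx,
      ψ.symm_apply_apply, Real.norm_of_nonneg (by rw [← hx]; positivity),
      div_mul_cancel₀ _ (hr.trans hr₀).ne']
  · simp only [hx]
    rw [intervalIntegral.integral_symm, hyoung]
  · have hpos : 0 < ‖x‖ := hx ▸ hr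
    rw [(hasGradientAt_integral_norm hφcont _ (norm_pos_iff.1 hpos)).gradient, hx, hφr, zero_div,
      zero_smul]

end
end

section
/- Assume g satisfies conditions (2.4) and let N ≥ 2. Let Ω₀ and Ω₁ be bounded convex open subsets of ℝ^N with closure(Ω₁) ⊂ Ω₀, set Ω = Ω₀ \ closure(Ω₁), Γ₀ = ∂Ω₀ and Γ₁ = ∂Ω₁. Let q₀ > 0 and c₁ > 0, and suppose u is C³ on an open neighborhood of closure(Ω), satisfies Σ_{i=1}^N ∂_i(g(q²) ∂_i u) = N in Ω with q = |∇u| and ∇u ≠ 0 in Ω, and satisfies u = 0 and |∇u| = q₀ on Γ₀, u = −c₁ and ∇u = 0 on Γ₁. Define v(x) = ∫₀^{q(x)} s G(s²) ds − u(x). Then ∫_Ω v(x) dx = |Ω₀| · ∫₀^{q₀} s G(s²) ds − c₁ N |Ω₁|, where |Ω₀| and |Ω₁| denote the Lebesgue measures of Ω₀ and Ω₁. -/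
open Set Filter MeasureTheory

noncomputable section

open scoped Topology

/-- The flux modulus `s ↦ g(s²) s`. -/
def fluxMod (g : ℝ → ℝ) (s : ℝ) : ℝ := g (s ^ 2) * s

/-- The primitive of the flux modulus which vanishes at `0`. -/
def fluxPrim (g : ℝ → ℝ) (t : ℝ) : ℝ := ∫ s in (0:ℝ)..t, fluxMod g s

lemma Cond24.contDiffAt {g : ℝ → ℝ} (hg : Cond24 g) {ξ : ℝ} (hξ : 0 < ξ) :
    ContDiffAt ℝ 3 g ξ :=
  (hg.1.contDiffAt (Ioi_mem_nhds hξ)).of_le (by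
    have h : ((3 : ℕ∞) : WithTop ℕ∞) ≤ ((⊤ : ℕ∞) : WithTop ℕ∞) := WithTop.coe_le_coe.2 le_top
    exact h)

lemma Cond24.fluxMod_nonneg {g : ℝ → ℝ} (hg : Cond24 g) {s : ℝ} (hs : 0 ≤ s) :
    0 ≤ fluxMod g s := by
  rcases hs.eq_or_lt with rfl | hs
  · simp [fluxMod]
  · exact mul_nonneg (hg.2.1 _ (by positivity)).le hs.le

lemma Cond24.fluxMod_pos {g : ℝ → ℝ} (hg : Cond24 g) {s : ℝ} (hs : 0 < s) :
    0 < fluxMod g s :=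
  mul_pos (hg.2.1 _ (by positivity)) hs

lemma Cond24.hasDerivAt_fluxMod {g : ℝ → ℝ} (hg : Cond24 g) {s : ℝ} (hs : 0 < s) :
    HasDerivAt (fluxMod g) (Gfun g (s ^ 2)) s := by
  have h1 : HasDerivAt g (deriv g (s ^ 2)) (s ^ 2) :=
    ((hg.contDiffAt (by positivity)).differentiableAt (by norm_num)).hasDerivAt
  have h2 : HasDerivAt (fun s : ℝ => s ^ 2) (2 * s) s := by simpa using hasDerivAt_pow 2 s
  have h3 := (HasDerivAt.comp (h := fun s : ℝ => s ^ 2) s h1 h2).mul (hasDerivAt_id s)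
  refine h3.congr_deriv ?_
  simp only [Gfun, Function.comp, id]
  ring

lemma Cond24.continuousOn_fluxMod {g : ℝ → ℝ} (hg : Cond24 g) :
    ContinuousOn (fluxMod g) (Ici 0) := by
  intro s hs
  rcases (mem_Ici.1 hs).eq_or_lt with rfl | hs
  · rw [← continuousWithinAt_sdiff_self, Ici_sdiff_left]
    have h : fluxMod g 0 = 0 := by simp [fluxMod]
    rw [ContinuousWithinAt, h]
    exact hg.2.2.1
  · exact (hg.hasDerivAt_fluxMod hs).continuousAt.continuousWithinAt

lemma Cond24.intervalIntegrable_fluxMod {g : ℝ → ℝ} (hg : Cond24 g) {a b : ℝ} (ha : 0 ≤ a)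
    (hb : 0 ≤ b) : IntervalIntegrable (fluxMod g) volume a b :=
  (hg.continuousOn_fluxMod.mono fun x hx => by
    rcases le_total a b with h | h
    · rw [uIcc_of_le h] at hx; exact ha.trans hx.1
    · rw [uIcc_of_ge h] at hx; exact hb.trans hx.1).intervalIntegrable

lemma Cond24.hasDerivAt_fluxPrim {g : ℝ → ℝ} (hg : Cond24 g) {s : ℝ} (hs : 0 < s) :
    HasDerivAt (fluxPrim g) (fluxMod g s) s := by
  refine intervalIntegral.integral_hasDerivAt_right (hg.intervalIntegrable_fluxMod le_rfl hs.le) ?_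
    (hg.hasDerivAt_fluxMod hs).continuousAt
  exact (hg.continuousOn_fluxMod.mono Ioi_subset_Ici_self).stronglyMeasurableAtFilter isOpen_Ioi s hs

lemma Cond24.continuousOn_fluxPrim {g : ℝ → ℝ} (hg : Cond24 g) :
    ContinuousOn (fluxPrim g) (Ici 0) := by
  intro s hs
  have hs : (0:ℝ) ≤ s := hs
  have h := intervalIntegral.continuousOn_primitive_interval
    (f := fluxMod g) (a := 0) (b := s + 1) (μ := volume)
    ((hg.continuousOn_fluxMod.mono (by rw [uIcc_of_le (by linarith)]; exact Icc_subset_Ici_self)).integrableOn_compact isCompact_uIcc)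
  rw [uIcc_of_le (by linarith)] at h
  refine (h s ⟨hs, by linarith⟩).mono_of_mem_nhdsWithin ?_
  rw [← Ici_inter_Iic]
  exact inter_mem_nhdsWithin _ (Iic_mem_nhds (by linarith))

lemma Cond24.integral_Gfun {g : ℝ → ℝ} (hg : Cond24 g) {q : ℝ} (hq : 0 ≤ q) :
    ∫ s in (0:ℝ)..q, s * Gfun g (s ^ 2) = q * fluxMod g q - fluxPrim g q := by
  have hcont : ContinuousOn (fun s => s * fluxMod g s - fluxPrim g s) (Icc 0 q) :=
    ((continuousOn_id.mul hg.continuousOn_fluxMod).sub hg.continuousOn_fluxPrim).mono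
      Icc_subset_Ici_self
  have hd : ∀ s ∈ Ioo 0 q, HasDerivAt (fun s => s * fluxMod g s - fluxPrim g s)
      (s * Gfun g (s ^ 2)) s := by
    intro s hs
    refine (((hasDerivAt_id s).mul (hg.hasDerivAt_fluxMod hs.1)).sub
      (hg.hasDerivAt_fluxPrim hs.1)).congr_deriv ?_
    simp
  rw [intervalIntegral.integral_eq_sub_of_hasDerivAt_of_le hq hcont hd]
  · simp [fluxPrim]
  · rw [intervalIntegrable_iff_integrableOn_Ioc_of_le hq]
    exact intervalIntegral.integrableOn_deriv_of_nonneg hcont hd fun s hs =>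
      mul_nonneg hs.1.le (hg.2.2.2.2 _ (by have := hs.1; positivity)).le

/-- The divergence of a vector field on `ℝ^N`. -/
def divergence {N : ℕ} (Z : EuclideanSpace ℝ (Fin N) → EuclideanSpace ℝ (Fin N))
    (x : EuclideanSpace ℝ (Fin N)) : ℝ :=
  ∑ i, fderiv ℝ (fun y => Z y i) x (eb N i)

section Divergence

variable {N : ℕ}

local notation "E" => EuclideanSpace ℝ (Fin N)

lemma sum_apply_eb (L : E →L[ℝ] ℝ) (z : E) : ∑ i, z i * L (eb N i) = L z := by
  have h : z = ∑ i, z i • eb N i := by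
    have := (EuclideanSpace.basisFun (Fin N) ℝ).sum_repr z
    simpa [eb] using this.symm
  conv_rhs => rw [h]
  simp [map_sum]

lemma divergence_eq_sum {Z : E → E} {x : E} (hZ : DifferentiableAt ℝ Z x) :
    divergence Z x = ∑ i, (fderiv ℝ Z x (eb N i)) i := by
  refine Finset.sum_congr rfl fun i _ => ?_
  have h := ((EuclideanSpace.proj i : E →L[ℝ] ℝ).hasFDerivAt.comp x
    hZ.hasFDerivAt).fderiv
  have h' : (fun y => Z y i) = (EuclideanSpace.proj i : E →L[ℝ] ℝ) ∘ Z := rfl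
  rw [h', h]
  rfl

lemma divergence_congr {Z Y : E → E} {x : E} (h : Z =ᶠ[𝓝 x] Y) :
    divergence Z x = divergence Y x := by
  refine Finset.sum_congr rfl fun i _ => ?_
  rw [Filter.EventuallyEq.fderiv_eq]
  filter_upwards [h] with y hy
  rw [hy]

lemma divergence_smul {f : E → ℝ} {Z : E → E} {x : E} (hf : DifferentiableAt ℝ f x)
    (hZ : DifferentiableAt ℝ Z x) :
    divergence (fun y => f y • Z y) x = f x * divergence Z x + fderiv ℝ f x (Z x) := by
  rw [divergence_eq_sum (Z := fun y => f y • Z y) (hf.smul hZ), divergence_eq_sum hZ, ← sum_apply_eb, Finset.mul_sum,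
    ← Finset.sum_add_distrib]
  refine Finset.sum_congr rfl fun i _ => ?_
  rw [fderiv_fun_smul hf hZ]
  simp
  ring

lemma divergence_sub {Z Y : E → E} {x : E} (hZ : DifferentiableAt ℝ Z x)
    (hY : DifferentiableAt ℝ Y x) :
    divergence (fun y => Z y - Y y) x = divergence Z x - divergence Y x := by
  rw [divergence_eq_sum (Z := fun y => Z y - Y y) (hZ.sub hY), divergence_eq_sum hZ, divergence_eq_sum hY,
    ← Finset.sum_sub_distrib]
  refine Finset.sum_congr rfl fun i _ => ?_
  rw [fderiv_fun_sub hZ hY]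
  simp

lemma divergence_id (x : E) : divergence (fun y : E => y) x = N := by
  rw [divergence_eq_sum (Z := fun y => y) differentiableAt_id]
  simp [eb]

lemma integral_fderiv_apply_eq_zero {f : E → ℝ} (hf : ContDiff ℝ 1 f) (hc : HasCompactSupport f)
    (v : E) : Integrable (fun x => fderiv ℝ f x v) ∧ ∫ x, fderiv ℝ f x v = 0 := by
  have hcont : Continuous fun x => fderiv ℝ f x v :=
    (hf.continuous_fderiv one_ne_zero).clm_apply continuous_const
  have hi : Integrable (fun x => fderiv ℝ f x v) :=
    hcont.integrable_of_hasCompactSupport (hc.fderiv_apply (𝕜 := ℝ) v)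
  have hfi : Integrable f := hf.continuous.integrable_of_hasCompactSupport hc
  refine ⟨hi, ?_⟩
  have h := integral_mul_fderiv_eq_neg_fderiv_mul_of_integrable (μ := volume) (𝕜 := ℝ)
    (f := fun _ : E => (1:ℝ)) (g := f) (v := v) (by simp) (by simpa using hi)
    (by simpa using hfi) (fun x _ => differentiableAt_const _)
    (fun x _ => hf.differentiable one_ne_zero x)
  simpa using h

/-- The divergence theorem for fields with compact support in an open set. -/
lemma setIntegral_divergence_eq_zero {Ω K : Set E} (hΩ : IsOpen Ω) (hK : IsCompact K) (hKΩ : K ⊆ Ω)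
    {Z : E → E} (hZ : ContDiffOn ℝ 1 Z Ω) (hZK : ∀ x ∈ Ω, x ∉ K → Z x = 0) :
    ∫ x in Ω, divergence Z x = 0 := by
  have h0 : ∀ x ∉ K, Ω.indicator Z x = 0 := fun x hx => by
    by_cases hxΩ : x ∈ Ω
    · rw [indicator_of_mem hxΩ, hZK x hxΩ hx]
    · exact indicator_of_notMem hxΩ _
  have h1 : ∀ x ∈ Ω, Ω.indicator Z =ᶠ[𝓝 x] Z := fun x hx => by
    filter_upwards [hΩ.mem_nhds hx] with y hy using indicator_of_mem hy _
  have h2 : ∀ x ∉ Ω, Ω.indicator Z =ᶠ[𝓝 x] fun _ => 0 := fun x hx => by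
    filter_upwards [hK.isClosed.isOpen_compl.mem_nhds fun h => hx (hKΩ h)] with y hy
    exact h0 y hy
  have hsm : ContDiff ℝ 1 (Ω.indicator Z) := by
    rw [contDiff_iff_contDiffAt]
    intro x
    by_cases hxΩ : x ∈ Ω
    · exact (hZ.contDiffAt (hΩ.mem_nhds hxΩ)).congr_of_eventuallyEq (h1 x hxΩ)
    · exact contDiffAt_const.congr_of_eventuallyEq (h2 x hxΩ)
  have hcs : ∀ i, HasCompactSupport fun y => Ω.indicator Z y i := fun i =>
    HasCompactSupport.intro hK fun x hx => by simp [h0 x hx]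
  have hsi : ∀ i, ContDiff ℝ 1 fun y => Ω.indicator Z y i := fun i =>
    (EuclideanSpace.proj i : E →L[ℝ] ℝ).contDiff.comp hsm
  have hz : ∫ x, divergence (Ω.indicator Z) x = 0 := by
    unfold divergence
    rw [integral_finsetSum _ fun i _ => (integral_fderiv_apply_eq_zero (hsi i) (hcs i) _).1]
    exact Finset.sum_eq_zero fun i _ => (integral_fderiv_apply_eq_zero (hsi i) (hcs i) _).2
  rw [← hz, ← setIntegral_eq_integral_of_forall_compl_eq_zero (s := Ω)
    (f := divergence (Ω.indicator Z))]
  · exact setIntegral_congr_fun hΩ.measurableSet fun x hx => (divergence_congr (h1 x hx)).symm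
  · intro x hx
    rw [divergence_congr (h2 x hx)]
    simp [divergence]

end Divergence

section Cutoff

open scoped Convolution Pointwise NNReal

variable {N : ℕ}

local notation "E" => EuclideanSpace ℝ (Fin N)

/-- Smooth mollification of a bounded Lipschitz function, keeping the Lipschitz constant and
the values at points around which the function is constant. -/
lemma exists_contDiff_lipschitzWith {c : E → ℝ} {K : ℝ≥0} (hc : LipschitzWith K c) {δ : ℝ}
    (hδ : 0 < δ) (hc1 : ∀ x y, |c x - c y| ≤ 1) :
    ∃ χ : E → ℝ, ContDiff ℝ 1 χ ∧ LipschitzWith K χ ∧ (∀ x, |χ x - c x| ≤ 1) ∧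
      ∀ x, (∀ y ∈ Metric.ball x δ, c y = c x) → χ x = c x := by
  let φ : ContDiffBump (0 : E) := ⟨δ / 2, δ, by positivity, by linarith⟩
  have hφc : HasCompactSupport (φ.normed (volume : Measure E)) := φ.hasCompactSupport_normed
  have hint : ∀ x, Integrable fun t => φ.normed (volume : Measure E) t * c (x - t) := fun x =>
    (φ.continuous_normed.mul (hc.continuous.comp (by fun_prop))).integrable_of_hasCompactSupport
      hφc.mul_right
  refine ⟨φ.normed volume ⋆[ContinuousLinearMap.lsmul ℝ ℝ, volume] c, ?_, ?_, ?_, ?_⟩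
  · exact hφc.contDiff_convolution_left _ φ.contDiff_normed hc.continuous.locallyIntegrable
  · refine LipschitzWith.of_dist_le_mul fun x y => ?_
    rw [Real.dist_eq, convolution_def, convolution_def]
    simp only [ContinuousLinearMap.lsmul_apply, smul_eq_mul]
    rw [← integral_sub (hint x) (hint y), ← Real.norm_eq_abs]
    have hb : ∫ t, φ.normed (volume : Measure E) t * (K * dist x y) = K * dist x y := by
      rw [integral_mul_const, φ.integral_normed, one_mul]
    rw [← hb]
    refine norm_integral_le_of_norm_le (φ.integrable_normed.mul_const _) (ae_of_all _ fun t => ?_)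
    rw [← mul_sub, norm_mul, Real.norm_of_nonneg (φ.nonneg_normed t)]
    refine mul_le_mul_of_nonneg_left ?_ (φ.nonneg_normed t)
    have := hc.dist_le_mul (x - t) (y - t)
    rwa [dist_sub_right, Real.dist_eq] at this
  · intro x
    exact φ.dist_normed_convolution_le hc.continuous.aestronglyMeasurable fun y _ => hc1 y x
  · intro x hx
    exact φ.normed_convolution_eq_right hx

lemma volume_gauge_lt {s : Set E} (hs : Convex ℝ s) (ho : IsOpen s) (h0 : (0 : E) ∈ s) (p : E)
    {t : ℝ} (ht : 0 < t) :
    volume.real {x | gauge s (x - p) < t} = t ^ N * volume.real s := by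
  have h1 : {x | gauge s (x - p) < t} = (fun x => x - p) ⁻¹' (t • s) := by
    ext x
    rw [mem_preimage, mem_smul_set_iff_inv_smul_mem₀ ht.ne', ← ho.interior_eq,
      ← gauge_lt_one_iff_mem_interior hs (ho.mem_nhds h0), gauge_smul_of_nonneg (by positivity),
      ho.interior_eq, smul_eq_mul, inv_mul_lt_one₀ ht]
    rfl
  simp only [sub_eq_add_neg] at h1 ⊢
  rw [h1, measureReal_def, measure_preimage_add_right, Measure.addHaar_smul, ENNReal.toReal_mul,
    ENNReal.toReal_ofReal (abs_nonneg _), abs_of_pos (by positivity)]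
  simp [measureReal_def]

/-- Smooth cutoffs vanishing near a bounded convex body, equal to `1` away from it, and with
uniformly bounded total variation. -/
lemma exists_cutoff {A : Set E} (hA : Convex ℝ A) (ho : IsOpen A) (hb : Bornology.IsBounded A)
    (hne : A.Nonempty) :
    ∃ (γ : E → ℝ) (C : ℝ), Continuous γ ∧ (∀ x, γ x ≤ 1 ↔ x ∈ closure A) ∧
      ∀ ε : ℝ, 0 < ε → ε ≤ 1 → ∃ χ : E → ℝ, ContDiff ℝ 1 χ ∧ (∀ x, |χ x| ≤ 2) ∧
        (∀ x, γ x ≤ 1 + ε → χ x = 0) ∧ (∀ x, 1 + 4 * ε ≤ γ x → χ x = 1) ∧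
        (∀ x, 1 + 4 * ε < γ x → fderiv ℝ χ x = 0) ∧
        Integrable (fun x => ‖fderiv ℝ χ x‖) ∧ ∫ x, ‖fderiv ℝ χ x‖ ≤ C := by
  obtain ⟨p, hp⟩ := hne
  set s : Set E := (fun y => y + p) ⁻¹' A with hs
  have hcs : Convex ℝ s := hA.translate_preimage_left p
  have hos : IsOpen s := ho.preimage (by fun_prop)
  have h0s : (0 : E) ∈ s := by simpa [hs] using hp
  have hnhds := hos.mem_nhds h0s
  have hbs : Bornology.IsBounded s := by
    have h : s ⊆ (fun y => y - p) '' A := fun y hy => ⟨y + p, hy, by simp⟩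
    refine Bornology.IsBounded.subset ?_ h
    exact (LipschitzWith.id.sub (LipschitzWith.const p)).isBounded_image hb
  obtain ⟨K, hK⟩ := hcs.lipschitz_gauge hnhds
  set γ : E → ℝ := fun x => gauge s (x - p) with hγ
  have hγc : Continuous γ := (continuous_gauge hcs hnhds).comp (by fun_prop)
  have hγK : ∀ x y, |γ x - γ y| ≤ K * dist x y := fun x y => by
    have := hK.dist_le_mul (x - p) (y - p)
    rwa [dist_sub_right, Real.dist_eq] at this
  refine ⟨γ, K * (5 * N * 6 ^ (N - 1) * volume.real s), hγc, fun x => ?_, fun ε hε hε1 => ?_⟩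
  · rw [hγ]
    simp only
    have h := (Homeomorph.addRight p).preimage_closure A
    simp only [Homeomorph.coe_addRight] at h
    rw [gauge_le_one_iff_mem_closure hcs hnhds, hs, ← h]
    simp
  set c : E → ℝ := fun x => max 0 (min 1 ((γ x - 1) / ε - 2)) with hc
  have hc01 : ∀ x, 0 ≤ c x ∧ c x ≤ 1 := fun x =>
    ⟨le_max_left _ _, max_le zero_le_one (min_le_left _ _)⟩
  have hc0 : ∀ x, γ x ≤ 1 + 2 * ε → c x = 0 := fun x hx => by
    refine max_eq_left ((min_le_right _ _).trans ?_)
    rw [sub_nonpos, div_le_iff₀ hε]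
    linarith
  have hc1 : ∀ x, 1 + 3 * ε ≤ γ x → c x = 1 := fun x hx => by
    have : 1 ≤ (γ x - 1) / ε - 2 := by
      rw [le_sub_iff_add_le, le_div_iff₀ hε]
      linarith
    simp [hc, this]
  set ε' : ℝ≥0 := ⟨ε, hε.le⟩ with hε'
  have hcL : LipschitzWith (K / ε') c := by
    have h1 : LipschitzWith (K / ε') fun x => (γ x - 1) / ε - 2 := by
      refine LipschitzWith.of_dist_le_mul fun x y => ?_
      have : (γ x - 1) / ε - 2 - ((γ y - 1) / ε - 2) = (γ x - γ y) / ε := by ring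
      rw [Real.dist_eq, this, abs_div, abs_of_pos hε]
      push_cast
      rw [div_mul_eq_mul_div]
      exact div_le_div_of_nonneg_right (hγK x y) hε.le
    exact (h1.const_min 1).const_max 0
  obtain ⟨χ, hχs, hχL, hχc, hχe⟩ := exists_contDiff_lipschitzWith hcL
    (δ := ε / (K + 1)) (by positivity) fun x y => abs_sub_le_iff.2
      ⟨by linarith [(hc01 x).2, (hc01 y).1], by linarith [(hc01 y).2, (hc01 x).1]⟩
  have hball : ∀ x, ∀ y ∈ Metric.ball x (ε / (K + 1)), |γ y - γ x| ≤ ε := fun x y hy => by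
    refine (hγK y x).trans ?_
    have h1 : dist y x ≤ ε / (K + 1) := (Metric.mem_ball.1 hy).le
    have hK0 : (0:ℝ) ≤ K := K.2
    calc (K:ℝ) * dist y x ≤ (K + 1) * (ε / (K + 1)) := by gcongr; linarith
      _ = ε := by field_simp
  have hχ0 : ∀ x, γ x ≤ 1 + ε → χ x = 0 := fun x hx => by
    rw [hχe x, hc0 x (by linarith)]
    intro y hy
    rw [hc0 x (by linarith), hc0 y (by linarith [(abs_le.1 (hball x y hy)).2])]
  have hχ1 : ∀ x, 1 + 4 * ε ≤ γ x → χ x = 1 := fun x hx => by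
    rw [hχe x, hc1 x (by linarith)]
    intro y hy
    rw [hc1 x (by linarith), hc1 y (by linarith [(abs_le.1 (hball x y hy)).1])]
  have hd1 : ∀ x, 1 + 4 * ε < γ x → fderiv ℝ χ x = 0 := fun x hx => by
    have : χ =ᶠ[𝓝 x] fun _ => 1 := by
      filter_upwards [(isOpen_lt continuous_const hγc).mem_nhds hx] with y hy
      exact hχ1 y (le_of_lt hy)
    rw [this.fderiv_eq]
    simp
  have hd0 : ∀ x, γ x < 1 + ε → fderiv ℝ χ x = 0 := fun x hx => by
    have : χ =ᶠ[𝓝 x] fun _ => 0 := by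
      filter_upwards [(isOpen_lt hγc continuous_const).mem_nhds hx] with y hy
      exact hχ0 y (le_of_lt hy)
    rw [this.fderiv_eq]
    simp
  have hfin : volume s ≠ ⊤ := hbs.measure_lt_top.ne
  set S : Set E := {x | γ x < 1 + 5 * ε} \ {x | γ x < 1} with hS
  have hAm : MeasurableSet {x | γ x < 1} := (isOpen_lt hγc continuous_const).measurableSet
  have hSm : MeasurableSet S := (isOpen_lt hγc continuous_const).measurableSet.diff hAm
  have hv1 := volume_gauge_lt hcs hos h0s p (t := 1 + 5 * ε) (by positivity)
  have hv2 := volume_gauge_lt hcs hos h0s p (t := 1) one_pos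
  have hspos : 0 < volume.real s :=
    ENNReal.toReal_pos (hos.measure_pos volume ⟨0, h0s⟩).ne' hfin
  have hfin5 : volume {x | γ x < 1 + 5 * ε} ≠ ⊤ := fun h => by
    have : (0:ℝ) = (1 + 5 * ε) ^ N * volume.real s := by
      rw [← hv1, measureReal_def, h]; rfl
    have h' : 0 < (1 + 5 * ε) ^ N * volume.real s := by positivity
    linarith
  have hSv : volume.real S ≤ ε * (5 * N * 6 ^ (N - 1) * volume.real s) := by
    have hsub : {x | γ x < 1} ⊆ {x | γ x < 1 + 5 * ε} := fun x (hx : γ x < 1) =>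
      show γ x < _ by linarith
    rw [hS, measureReal_sdiff hsub hAm hfin5, hv1, hv2]
    have h1 := abs_pow_sub_pow_le (1 + 5 * ε) 1 N
    rw [add_sub_cancel_left, abs_of_pos (show 0 < 5 * ε by positivity),
      abs_of_pos (show 0 < 1 + 5 * ε by positivity), abs_one,
      max_eq_left (by linarith)] at h1
    have h2 : (1 + 5 * ε) ^ (N - 1) ≤ 6 ^ (N - 1) := pow_le_pow_left₀ (by positivity) (by linarith) _
    rw [← sub_mul]
    calc _ ≤ (5 * ε * N * 6 ^ (N - 1)) * volume.real s := by
          refine mul_le_mul_of_nonneg_right ((le_abs_self _).trans (h1.trans ?_)) hspos.le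
          gcongr
      _ = _ := by ring
  have hdom : ∀ x, ‖fderiv ℝ χ x‖ ≤ S.indicator (fun _ => K / ε) x := fun x => by
    by_cases hx : x ∈ S
    · rw [indicator_of_mem hx]
      exact norm_fderiv_le_of_lipschitz ℝ hχL
    · rw [indicator_of_notMem hx]
      by_cases h : γ x < 1
      · rw [hd0 x (by linarith), norm_zero]
      · have : ¬ γ x < 1 + 5 * ε := fun h' => hx ⟨h', h⟩
        rw [hd1 x (by linarith), norm_zero]
  have hIS : Integrable (S.indicator fun _ : E => (K / ε : ℝ)) := by
    rw [integrable_indicator_iff hSm]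
    exact integrableOn_const (measure_ne_top_of_subset sdiff_subset hfin5)
  have hI : Integrable fun x => ‖fderiv ℝ χ x‖ :=
    hIS.mono' (hχs.continuous_fderiv one_ne_zero).norm.aestronglyMeasurable
      (ae_of_all _ fun x => by rw [norm_norm]; exact hdom x)
  refine ⟨χ, hχs, fun x => ?_, hχ0, hχ1, hd1, hI, ?_⟩
  · have h1 := abs_le.1 (hχc x)
    have h2 := hc01 x
    exact abs_le.2 ⟨by linarith, by linarith⟩
  · refine (integral_mono hI hIS hdom).trans ?_
    rw [integral_indicator_const _ hSm, smul_eq_mul]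
    calc volume.real S * (K / ε) ≤ ε * (5 * N * 6 ^ (N - 1) * volume.real s) * (K / ε) := by gcongr
      _ = _ := by field_simp

end Cutoff

section Ring

variable {N : ℕ}

local notation "E" => EuclideanSpace ℝ (Fin N)

/-- A function `u` of class `C³` near the closure of the ring `Ω₀ \ closure Ω₁`, negative inside
the ring, vanishing on the outer boundary and equal to `-c` on the inner boundary. -/
structure RingPotential (Ω₀ Ω₁ U : Set (EuclideanSpace ℝ (Fin N)))
    (u : EuclideanSpace ℝ (Fin N) → ℝ) (c : ℝ) : Prop where
  isOpen_outer : IsOpen Ω₀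
  isOpen_inner : IsOpen Ω₁
  isBounded_outer : Bornology.IsBounded Ω₀
  convex_inner : Convex ℝ Ω₁
  nonempty_inner : Ω₁.Nonempty
  closure_inner_subset : closure Ω₁ ⊆ Ω₀
  isOpen_nhd : IsOpen U
  closure_subset_nhd : closure (Ω₀ \ closure Ω₁) ⊆ U
  contDiffOn : ContDiffOn ℝ 3 u U
  pos : 0 < c
  eq_outer : ∀ x ∈ frontier Ω₀, u x = 0
  eq_inner : ∀ x ∈ frontier Ω₁, u x = -c
  neg : ∀ x ∈ Ω₀ \ closure Ω₁, u x < 0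

lemma notMem_of_mem_closure_ring {Ω₀ Ω₁ : Set E} (h₁ : IsOpen Ω₁) {x : E}
    (hx : x ∈ closure (Ω₀ \ closure Ω₁)) : x ∉ Ω₁ := fun h => by
  obtain ⟨y, hy1, hy2⟩ := mem_closure_iff.1 hx Ω₁ h₁ h
  exact hy2.2 (subset_closure hy1)

lemma mem_frontier_of_mem_closure_ring {Ω₀ Ω₁ : Set E} (h₀ : IsOpen Ω₀) (h₁ : IsOpen Ω₁) {x : E}
    (hx : x ∈ closure (Ω₀ \ closure Ω₁)) :
    x ∈ Ω₀ \ closure Ω₁ ∨ x ∈ frontier Ω₀ ∨ x ∈ frontier Ω₁ := by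
  rw [h₀.frontier_eq, h₁.frontier_eq]
  by_cases hx0 : x ∈ Ω₀
  · by_cases hx1 : x ∈ closure Ω₁
    · exact Or.inr (Or.inr ⟨hx1, notMem_of_mem_closure_ring h₁ hx⟩)
    · exact Or.inl ⟨hx0, hx1⟩
  · exact Or.inr (Or.inl ⟨closure_mono sdiff_subset hx, hx0⟩)

/-- A function without critical points in the ring is negative there as soon as its boundary values
are `0` and `-c`. -/
lemma neg_of_gradient_ne_zero {Ω₀ Ω₁ : Set E} (h₀ : IsOpen Ω₀) (h₁ : IsOpen Ω₁)
    (hb : Bornology.IsBounded Ω₀) {u : E → ℝ} (hu : ContinuousOn u (closure (Ω₀ \ closure Ω₁)))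
    {c : ℝ} (hc : 0 < c) (hu0 : ∀ x ∈ frontier Ω₀, u x = 0) (hu1 : ∀ x ∈ frontier Ω₁, u x = -c)
    (hgrad : ∀ x ∈ Ω₀ \ closure Ω₁, gradient u x ≠ 0) :
    ∀ x ∈ Ω₀ \ closure Ω₁, u x < 0 := by
  have hcpt : IsCompact (closure (Ω₀ \ closure Ω₁)) := (hb.subset sdiff_subset).isCompact_closure
  have hopen : IsOpen (Ω₀ \ closure Ω₁) := h₀.sdiff isClosed_closure
  have hnomax : ∀ x ∈ Ω₀ \ closure Ω₁, ¬ ∀ y ∈ closure (Ω₀ \ closure Ω₁), u y ≤ u x := by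
    intro x hx hmax
    have hloc : IsLocalMax u x := by
      filter_upwards [hopen.mem_nhds hx] with y hy using hmax y (subset_closure hy)
    exact hgrad x hx (by simp [gradient, hloc.fderiv_eq_zero])
  intro x hx
  obtain ⟨m, hm, hmax⟩ := hcpt.exists_isMaxOn ⟨x, subset_closure hx⟩ hu
  have hm0 : u m ≤ 0 := by
    rcases mem_frontier_of_mem_closure_ring h₀ h₁ hm with h | h | h
    · exact absurd (fun y hy => hmax hy) (hnomax m h)
    · exact (hu0 m h).le
    · rw [hu1 m h]; linarith
  refine lt_of_le_of_ne ((hmax (subset_closure hx)).trans hm0) fun h => hnomax x hx fun y hy => ?_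
  rw [h]
  exact (hmax hy).trans hm0

namespace RingPotential

variable {Ω₀ Ω₁ U : Set (EuclideanSpace ℝ (Fin N))} {u : EuclideanSpace ℝ (Fin N) → ℝ} {c : ℝ}

lemma isOpen_ring (h : RingPotential Ω₀ Ω₁ U u c) : IsOpen (Ω₀ \ closure Ω₁) :=
  h.isOpen_outer.sdiff isClosed_closure

lemma isCompact_closure (h : RingPotential Ω₀ Ω₁ U u c) : IsCompact (closure (Ω₀ \ closure Ω₁)) :=
  (h.isBounded_outer.subset sdiff_subset).isCompact_closure

lemma integrableOn_of_continuousOn (h : RingPotential Ω₀ Ω₁ U u c) {f : E → ℝ}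
    (hf : ContinuousOn f (closure (Ω₀ \ closure Ω₁))) : IntegrableOn f (Ω₀ \ closure Ω₁) :=
  (hf.integrableOn_compact h.isCompact_closure).mono_set subset_closure

lemma contDiffOn_one (h : RingPotential Ω₀ Ω₁ U u c) : ContDiffOn ℝ 1 u U :=
  h.contDiffOn.of_le (by norm_num)

lemma continuousOn (h : RingPotential Ω₀ Ω₁ U u c) :
    ContinuousOn u (closure (Ω₀ \ closure Ω₁)) :=
  h.contDiffOn.continuousOn.mono h.closure_subset_nhd

lemma continuousOn_fderiv (h : RingPotential Ω₀ Ω₁ U u c) :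
    ContinuousOn (fderiv ℝ u) (closure (Ω₀ \ closure Ω₁)) :=
  (h.contDiffOn_one.continuousOn_fderiv_of_isOpen h.isOpen_nhd le_rfl).mono h.closure_subset_nhd

lemma differentiableAt (h : RingPotential Ω₀ Ω₁ U u c) {x : E} (hx : x ∈ Ω₀ \ closure Ω₁) :
    DifferentiableAt ℝ u x :=
  (h.contDiffOn_one.contDiffAt (h.isOpen_nhd.mem_nhds (h.closure_subset_nhd
    (subset_closure hx)))).differentiableAt one_ne_zero

lemma continuousOn_deriv_comp (h : RingPotential Ω₀ Ω₁ U u c) {η : ℝ → ℝ} (hη : ContDiff ℝ 1 η) :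
    ContinuousOn (fun x => deriv η (u x)) (closure (Ω₀ \ closure Ω₁)) :=
  (hη.continuous_deriv le_rfl).comp_continuousOn h.continuousOn

lemma fderiv_comp_apply (h : RingPotential Ω₀ Ω₁ U u c) {η : ℝ → ℝ} (hη : ContDiff ℝ 1 η) {x : E}
    (hx : x ∈ Ω₀ \ closure Ω₁) (z : E) :
    fderiv ℝ (fun y => η (u y)) x z = deriv η (u x) * fderiv ℝ u x z := by
  have h1 := ((hη.differentiable one_ne_zero (u x)).hasDerivAt.comp_hasFDerivAt x
    (h.differentiableAt hx).hasFDerivAt).fderiv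
  have h2 : (fun y => η (u y)) = η ∘ u := rfl
  rw [h2, h1]
  simp

lemma contDiffOn_comp (h : RingPotential Ω₀ Ω₁ U u c) {η : ℝ → ℝ} (hη : ContDiff ℝ 1 η) :
    ContDiffOn ℝ 1 (fun y => η (u y)) (Ω₀ \ closure Ω₁) :=
  hη.comp_contDiffOn (h.contDiffOn_one.mono (subset_closure.trans h.closure_subset_nhd))

lemma isCompact_sublevel (h : RingPotential Ω₀ Ω₁ U u c) (δ : ℝ) :
    IsCompact {x ∈ closure (Ω₀ \ closure Ω₁) | u x ≤ -δ} := by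
  have := h.continuousOn.preimage_isClosed_of_isClosed isClosed_closure (isClosed_Iic (a := -δ))
  exact h.isCompact_closure.of_isClosed_subset this fun x hx => hx.1

/-- Integration by parts against a function of `u` for a field vanishing on the inner boundary. -/
lemma integral_comp_mul_divergence (h : RingPotential Ω₀ Ω₁ U u c) {η : ℝ → ℝ}
    (hη : ContDiff ℝ 1 η) (hη1 : ∀ t, |η t| ≤ 1) {δ : ℝ} (hδ : 0 < δ) (hη0 : ∀ t, -δ ≤ t → η t = 0)
    {Z : E → E} (hZ : ContinuousOn Z (closure (Ω₀ \ closure Ω₁)))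
    (hZ1 : ContDiffOn ℝ 1 Z (Ω₀ \ closure Ω₁)) (hZ0 : ∀ x ∈ frontier Ω₁, Z x = 0)
    (hd : IntegrableOn (divergence Z) (Ω₀ \ closure Ω₁)) :
    ∫ x in Ω₀ \ closure Ω₁, η (u x) * divergence Z x
      = - ∫ x in Ω₀ \ closure Ω₁, deriv η (u x) * fderiv ℝ u x (Z x) := by
  set Ω := Ω₀ \ closure Ω₁ with hΩ
  obtain ⟨γ, C, hγ, hγ1, hcut⟩ := exists_cutoff h.convex_inner h.isOpen_inner
    (h.isBounded_outer.subset (subset_closure.trans h.closure_inner_subset)) h.nonempty_inner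
  choose! χ hχs hχ2 hχ0 hχ1 hχd hχi hχC using hcut
  have hC : 0 ≤ C := (integral_nonneg fun x => norm_nonneg _).trans (hχC 1 one_pos le_rfl)
  have hI1 : IntegrableOn (fun x => η (u x) * divergence Z x) Ω :=
    hd.bdd_mul (c := 1) (((hη.continuous.comp_continuousOn h.continuousOn).mono
      subset_closure).aestronglyMeasurable h.isOpen_ring.measurableSet) (ae_of_all _ fun x => hη1 _)
  have hI2 : IntegrableOn (fun x => deriv η (u x) * fderiv ℝ u x (Z x)) Ω :=
    h.integrableOn_of_continuousOn
      ((h.continuousOn_deriv_comp hη).mul (h.continuousOn_fderiv.clm_apply hZ))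
  have hI := hI1.add hI2
  rw [eq_neg_iff_add_eq_zero, ← integral_add hI1 hI2]
  have hone : ∀ ε, 0 < ε → ε ≤ 1 →
      ∫ x in Ω, χ ε x * (η (u x) * divergence Z x + deriv η (u x) * fderiv ℝ u x (Z x))
        = - ∫ x in Ω, η (u x) * fderiv ℝ (χ ε) x (Z x) := by
    intro ε hε hε1
    have hK : IsCompact ({x ∈ closure Ω | u x ≤ -δ} ∩ {x | 1 + ε ≤ γ x}) :=
      (h.isCompact_sublevel δ).inter_right (isClosed_le continuous_const hγ)
    have hKΩ : ({x ∈ closure Ω | u x ≤ -δ} ∩ {x | 1 + ε ≤ γ x}) ⊆ Ω := by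
      rintro x ⟨⟨hx, hxu⟩, hxγ : 1 + ε ≤ γ x⟩
      rcases mem_frontier_of_mem_closure_ring h.isOpen_outer h.isOpen_inner hx with h' | h' | h'
      · exact h'
      · rw [h.eq_outer x h'] at hxu; linarith
      · have := (hγ1 x).2 (frontier_subset_closure h'); linarith
    have hdiv := setIntegral_divergence_eq_zero (Z := fun x => χ ε x • (η (u x) • Z x))
      h.isOpen_ring hK hKΩ
      ((hχs ε hε hε1).contDiffOn.smul ((h.contDiffOn_comp hη).smul hZ1)) (by
        intro x hx hxK
        by_cases hxu : u x ≤ -δ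
        · have : ¬ 1 + ε ≤ γ x := fun h' => hxK ⟨⟨subset_closure hx, hxu⟩, h'⟩
          simp only [hχ0 ε hε hε1 x (by linarith), zero_smul]
        · simp only [hη0 (u x) (by linarith), zero_smul, smul_zero])
    have hcongr : ∀ x ∈ Ω, divergence (fun x => χ ε x • (η (u x) • Z x)) x
        = χ ε x * (η (u x) * divergence Z x + deriv η (u x) * fderiv ℝ u x (Z x))
          + η (u x) * fderiv ℝ (χ ε) x (Z x) := by
      intro x hx
      have hZd : DifferentiableAt ℝ Z x :=
        (hZ1.contDiffAt (h.isOpen_ring.mem_nhds hx)).differentiableAt one_ne_zero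
      have hηd : DifferentiableAt ℝ (fun y => η (u y)) x :=
        ((h.contDiffOn_comp hη).contDiffAt (h.isOpen_ring.mem_nhds hx)).differentiableAt one_ne_zero
      rw [divergence_smul (Z := fun y => η (u y) • Z y) ((hχs ε hε hε1).differentiable one_ne_zero x) (hηd.smul hZd),
        divergence_smul hηd hZd, h.fderiv_comp_apply hη hx, map_smul, smul_eq_mul]
    rw [setIntegral_congr_fun h.isOpen_ring.measurableSet hcongr, integral_add] at hdiv
    · linarith
    · exact hI.bdd_mul (c := 2) (hχs ε hε hε1).continuous.aestronglyMeasurable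
        (ae_of_all _ fun x => hχ2 ε hε hε1 x)
    · exact h.integrableOn_of_continuousOn ((hη.continuous.comp_continuousOn h.continuousOn).mul
        (((hχs ε hε hε1).continuous_fderiv one_ne_zero).continuousOn.clm_apply hZ))
  have hεpos : ∀ k : ℕ, (0:ℝ) < 1 / (k + 1) := fun k => by positivity
  have hεle : ∀ k : ℕ, (1:ℝ) / (k + 1) ≤ 1 := fun k => by
    rw [div_le_one (by positivity)]; linarith [(Nat.cast_nonneg k : (0:ℝ) ≤ k)]
  have hlim : Tendsto (fun k : ℕ => ∫ x in Ω, χ (1 / (k + 1)) x *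
      (η (u x) * divergence Z x + deriv η (u x) * fderiv ℝ u x (Z x))) atTop
      (𝓝 (∫ x in Ω, (η (u x) * divergence Z x + deriv η (u x) * fderiv ℝ u x (Z x)))) := by
    refine tendsto_integral_of_dominated_convergence
      (fun x => 2 * ‖η (u x) * divergence Z x + deriv η (u x) * fderiv ℝ u x (Z x)‖)
      (fun k => (hχs _ (hεpos k) (hεle k)).continuous.aestronglyMeasurable.mul
        hI.aestronglyMeasurable) (hI.norm.const_mul 2) (fun k => ae_of_all _ fun x => ?_) ?_
    · rw [norm_mul]
      exact mul_le_mul_of_nonneg_right (hχ2 _ (hεpos k) (hεle k) x) (norm_nonneg _)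
    · refine (ae_restrict_iff' h.isOpen_ring.measurableSet).2 (ae_of_all _ fun x hx => ?_)
      have hx1 : 1 < γ x := not_le.1 fun h' => hx.2 ((hγ1 x).1 h')
      refine tendsto_const_nhds.congr' ?_
      filter_upwards [tendsto_one_div_add_atTop_nhds_zero_nat.eventually_lt_const
        (show (0:ℝ) < (γ x - 1) / 4 by linarith)] with k hk
      rw [hχ1 _ (hεpos k) (hεle k) x (by linarith), one_mul]
  refine abs_eq_zero.1 (le_antisymm (le_of_forall_pos_le_add fun τ hτ => ?_) (abs_nonneg _))
  rw [zero_add]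
  set τ' := τ / (C + 1) with hτ'
  have hτ'0 : 0 < τ' := by positivity
  obtain ⟨m, hm1, hm⟩ : ∃ m : ℝ, 1 < m ∧ ∀ x ∈ closure Ω, γ x < m → ‖Z x‖ ≤ τ' := by
    have hBc : IsCompact {x ∈ closure Ω | τ' ≤ ‖Z x‖} :=
      h.isCompact_closure.of_isClosed_subset
        (hZ.norm.preimage_isClosed_of_isClosed isClosed_closure (isClosed_Ici (a := τ')))
        fun x hx => hx.1
    rcases eq_empty_or_nonempty {x ∈ closure Ω | τ' ≤ ‖Z x‖} with he | hne
    · refine ⟨2, by norm_num, fun x hx _ => le_of_lt (not_le.1 fun h' => ?_)⟩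
      exact (he ▸ (⟨hx, h'⟩ : x ∈ {x ∈ closure Ω | τ' ≤ ‖Z x‖}) : x ∈ (∅ : Set E))
    · obtain ⟨y, hy, hmin⟩ := hBc.exists_isMinOn hne hγ.continuousOn
      refine ⟨γ y, not_le.1 fun h' => ?_, fun x hx hxm => le_of_lt (not_le.1 fun h' => ?_)⟩
      · have hyf : y ∈ frontier Ω₁ := by
          rw [h.isOpen_inner.frontier_eq]
          exact ⟨(hγ1 y).1 h', notMem_of_mem_closure_ring h.isOpen_inner hy.1⟩
        have := hy.2
        rw [hZ0 y hyf, norm_zero] at this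
        linarith
      · exact absurd (hmin (show x ∈ {x ∈ closure Ω | τ' ≤ ‖Z x‖} from ⟨hx, h'⟩)) (not_le.2 hxm)
  refine le_of_tendsto hlim.abs ?_
  filter_upwards [tendsto_one_div_add_atTop_nhds_zero_nat.eventually_lt_const
    (show (0:ℝ) < (m - 1) / 4 by linarith)] with k hk
  rw [hone _ (hεpos k) (hεle k), abs_neg, ← Real.norm_eq_abs]
  set ε : ℝ := 1 / (k + 1) with hε
  calc ‖∫ x in Ω, η (u x) * fderiv ℝ (χ ε) x (Z x)‖
      ≤ ∫ x in Ω, τ' * ‖fderiv ℝ (χ ε) x‖ := by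
        refine norm_integral_le_of_norm_le ((hχi ε (hεpos k) (hεle k)).integrableOn.const_mul _) ?_
        refine (ae_restrict_iff' h.isOpen_ring.measurableSet).2 (ae_of_all _ fun x hx => ?_)
        rw [norm_mul]
        have h1 : ‖fderiv ℝ (χ ε) x (Z x)‖ ≤ τ' * ‖fderiv ℝ (χ ε) x‖ := by
          by_cases hx' : 1 + 4 * ε < γ x
          · simp [hχd ε (hεpos k) (hεle k) x hx']
          · rw [mul_comm]
            refine (ContinuousLinearMap.le_opNorm _ _).trans ?_
            exact mul_le_mul_of_nonneg_left (hm x (subset_closure hx) (by linarith)) (norm_nonneg _)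
        calc ‖η (u x)‖ * ‖fderiv ℝ (χ ε) x (Z x)‖ ≤ 1 * (τ' * ‖fderiv ℝ (χ ε) x‖) :=
              mul_le_mul (hη1 _) h1 (norm_nonneg _) zero_le_one
          _ = _ := one_mul _
    _ = τ' * ∫ x in Ω, ‖fderiv ℝ (χ ε) x‖ := integral_const_mul _ _
    _ ≤ τ' * C := by
        refine mul_le_mul_of_nonneg_left ?_ hτ'0.le
        exact (setIntegral_le_integral (hχi ε (hεpos k) (hεle k))
          (ae_of_all _ fun x => norm_nonneg _)).trans (hχC ε (hεpos k) (hεle k))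
    _ ≤ τ := by
        rw [hτ', div_mul_eq_mul_div, div_le_iff₀ (by linarith)]
        nlinarith

/-- Integration by parts of a function of `u`, extended by `1` inside `Ω₁`, against the position
field. -/
lemma integral_comp_add_volume (h : RingPotential Ω₀ Ω₁ U u c) {η : ℝ → ℝ}
    (hη : ContDiff ℝ 1 η) {δ : ℝ} (hδ : 0 < δ) (hη0 : ∀ t, -δ ≤ t → η t = 0)
    {b : ℝ} (hb : b < c) (hη1 : ∀ t, t ≤ -b → η t = 1) :
    N * (∫ x in Ω₀ \ closure Ω₁, η (u x)) + N * volume.real Ω₁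
      = - ∫ x in Ω₀ \ closure Ω₁, deriv η (u x) * fderiv ℝ u x x := by
  classical
  set Ω := Ω₀ \ closure Ω₁ with hΩ
  set ψ : E → ℝ := fun x => if x ∈ closure Ω₁ then 1 else η (u x) with hψ
  have hψΩ : ∀ x ∈ Ω, ψ =ᶠ[𝓝 x] fun y => η (u y) := fun x hx => by
    filter_upwards [h.isOpen_ring.mem_nhds hx] with y hy
    exact if_neg hy.2
  have hψ1 : ∀ x ∈ closure Ω₁, ψ =ᶠ[𝓝 x] fun _ => 1 := fun x hx => by
    by_cases hxΩ : x ∈ closure Ω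
    · have hxf : x ∈ frontier Ω₁ := by
        rw [h.isOpen_inner.frontier_eq]
        exact ⟨hx, notMem_of_mem_closure_ring h.isOpen_inner hxΩ⟩
      have hxU := h.closure_subset_nhd hxΩ
      have huc : ContinuousAt u x := h.contDiffOn.continuousOn.continuousAt
        (h.isOpen_nhd.mem_nhds hxU)
      filter_upwards [huc.eventually_lt_const
        (show u x < -b by rw [h.eq_inner x hxf]; linarith)] with y hy
      simp only [hψ]
      split_ifs
      · rfl
      · exact hη1 _ hy.le
    · filter_upwards [isClosed_closure.isOpen_compl.mem_nhds hxΩ,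
        h.isOpen_outer.mem_nhds (h.closure_inner_subset hx)] with y hy1 hy2
      refine if_pos (by_contra fun hy3 => hy1 (subset_closure ⟨hy2, hy3⟩))
  have hψs : ContDiffOn ℝ 1 ψ Ω₀ := fun x hx => by
    refine ContDiffAt.contDiffWithinAt ?_
    by_cases hx1 : x ∈ closure Ω₁
    · exact contDiffAt_const.congr_of_eventuallyEq (hψ1 x hx1)
    · exact ((h.contDiffOn_comp hη).contDiffAt (h.isOpen_ring.mem_nhds ⟨hx, hx1⟩)).congr_of_eventuallyEq
        (hψΩ x ⟨hx, hx1⟩)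
  have hK1 : IsCompact (closure Ω₁) :=
    (h.isBounded_outer.subset (subset_closure.trans h.closure_inner_subset)).isCompact_closure
  have hsub : closure Ω₁ ∪ {x ∈ closure Ω | u x ≤ -δ} ⊆ Ω₀ := by
    rintro x (hx | ⟨hx, hxu⟩)
    · exact h.closure_inner_subset hx
    · rcases mem_frontier_of_mem_closure_ring h.isOpen_outer h.isOpen_inner hx with h' | h' | h'
      · exact h'.1
      · rw [h.eq_outer x h'] at hxu; linarith
      · exact h.closure_inner_subset (frontier_subset_closure h')
  have hdiv := setIntegral_divergence_eq_zero (Z := fun x => ψ x • x) h.isOpen_outer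
    (hK1.union (h.isCompact_sublevel δ)) hsub (hψs.smul contDiffOn_id) (by
      intro x hx hxK
      have hx1 : x ∉ closure Ω₁ := fun h' => hxK (Or.inl h')
      have hxu : ¬ u x ≤ -δ := fun h' => hxK (Or.inr ⟨subset_closure ⟨hx, hx1⟩, h'⟩)
      simp only [hψ, if_neg hx1, hη0 (u x) (by linarith), zero_smul])
  have hc1 : ∀ x ∈ closure Ω₁, divergence (fun y => ψ y • y) x = N := fun x hx => by
    rw [divergence_congr (Y := fun y => y)]
    · exact divergence_id x
    · filter_upwards [hψ1 x hx] with y hy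
      rw [hy, one_smul]
  have hcΩ : ∀ x ∈ Ω, divergence (fun y => ψ y • y) x
      = N * η (u x) + deriv η (u x) * fderiv ℝ u x x := fun x hx => by
    rw [divergence_congr (Y := fun y => η (u y) • y),
      divergence_smul (Z := fun y => y) (((h.contDiffOn_comp hη).contDiffAt
        (h.isOpen_ring.mem_nhds hx)).differentiableAt one_ne_zero) differentiableAt_id,
      divergence_id, h.fderiv_comp_apply hη hx, mul_comm]
    filter_upwards [hψΩ x hx] with y hy
    rw [hy]
  have hI1 : IntegrableOn (fun x => N * η (u x)) Ω := h.integrableOn_of_continuousOn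
    (continuousOn_const.mul (hη.continuous.comp_continuousOn h.continuousOn))
  have hI2 : IntegrableOn (fun x => deriv η (u x) * fderiv ℝ u x x) Ω :=
    h.integrableOn_of_continuousOn
      ((h.continuousOn_deriv_comp hη).mul (h.continuousOn_fderiv.clm_apply continuousOn_id))
  have hvol : volume.real (closure Ω₁) = volume.real Ω₁ := by
    refine measureReal_congr ?_
    exact (closure_ae_eq_of_null_frontier (h.convex_inner.addHaar_frontier volume))
  have hun : Ω₀ = closure Ω₁ ∪ Ω := by
    rw [hΩ, union_sdiff_cancel h.closure_inner_subset]
  rw [hun, setIntegral_union disjoint_sdiff_right h.isOpen_ring.measurableSet,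
    setIntegral_congr_fun isClosed_closure.measurableSet hc1,
    setIntegral_congr_fun h.isOpen_ring.measurableSet hcΩ, integral_add hI1 hI2,
    integral_const_mul, setIntegral_const, hvol, smul_eq_mul] at hdiv
  · linarith
  · exact (integrableOn_congr_fun hc1 isClosed_closure.measurableSet).2
      (integrableOn_const hK1.measure_lt_top.ne)
  · exact (integrableOn_congr_fun hcΩ h.isOpen_ring.measurableSet).2 (hI1.add hI2)

end RingPotential

/-- Smooth antitone functions equal to `1` on `t ≤ -2/(n+1)` and to `0` on `-1/(n+1) ≤ t`. -/
def outerCutoff (n : ℕ) (t : ℝ) : ℝ := Real.smoothTransition (-(n + 1) * t - 1)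

lemma contDiff_outerCutoff (n : ℕ) : ContDiff ℝ 1 (outerCutoff n) :=
  (Real.smoothTransition.contDiff (n := 1)).comp (by fun_prop)

lemma outerCutoff_eq_one {n : ℕ} {t : ℝ} (ht : t ≤ -(2 / (n + 1))) : outerCutoff n t = 1 := by
  refine Real.smoothTransition.one_of_one_le ?_
  have hn : (0:ℝ) < n + 1 := by positivity
  have h1 : (2 / (n + 1)) ≤ -t := by linarith
  rw [div_le_iff₀ hn] at h1
  linarith

lemma outerCutoff_eq_zero {n : ℕ} {t : ℝ} (ht : -(1 / (n + 1)) ≤ t) : outerCutoff n t = 0 := by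
  refine Real.smoothTransition.zero_of_nonpos ?_
  have hn : (0:ℝ) < n + 1 := by positivity
  have h1 : -t ≤ (1 / (n + 1)) := by linarith
  rw [le_div_iff₀ hn] at h1
  linarith

lemma abs_outerCutoff_le_one (n : ℕ) (t : ℝ) : |outerCutoff n t| ≤ 1 := by
  unfold outerCutoff
  rw [abs_of_nonneg (Real.smoothTransition.nonneg _)]
  exact Real.smoothTransition.le_one _

lemma deriv_outerCutoff_nonpos (n : ℕ) (t : ℝ) : deriv (outerCutoff n) t ≤ 0 := by
  refine Antitone.deriv_nonpos fun a b hab => Real.smoothTransition.monotone ?_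
  have hn : (0:ℝ) < n + 1 := by positivity
  nlinarith

lemma deriv_outerCutoff_eq_zero {n : ℕ} {t : ℝ} (ht : t < -(2 / (n + 1))) :
    deriv (outerCutoff n) t = 0 := by
  have : outerCutoff n =ᶠ[𝓝 t] fun _ => 1 := by
    filter_upwards [Iio_mem_nhds ht] with s hs using outerCutoff_eq_one (le_of_lt hs)
  rw [this.deriv_eq, deriv_const]

lemma tendsto_two_div_add_atTop : Tendsto (fun n : ℕ => (2:ℝ) / (n + 1)) atTop (𝓝 0) := by
  have := (tendsto_one_div_add_atTop_nhds_zero_nat (𝕜 := ℝ)).const_mul 2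
  simpa only [mul_one_div, mul_zero] using this

namespace RingPotential

variable {Ω₀ Ω₁ U : Set (EuclideanSpace ℝ (Fin N))} {u : EuclideanSpace ℝ (Fin N) → ℝ} {c : ℝ}

/-- Contributions of quantities vanishing on the outer boundary disappear in the limit. -/
lemma tendsto_integral_deriv_outerCutoff (h : RingPotential Ω₀ Ω₁ U u c) {R P : E → ℝ}
    (hR : ContinuousOn R (closure (Ω₀ \ closure Ω₁)))
    (hP : ContinuousOn P (closure (Ω₀ \ closure Ω₁)))
    (hR0 : ∀ x ∈ closure (Ω₀ \ closure Ω₁), x ∈ frontier Ω₀ → R x = 0)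
    (hP0 : ∀ x ∈ closure (Ω₀ \ closure Ω₁), x ∈ frontier Ω₀ → 0 < P x) {B : ℝ} (hB : 0 ≤ B)
    (hPB : ∀ n : ℕ, - ∫ x in Ω₀ \ closure Ω₁, deriv (outerCutoff n) (u x) * P x ≤ B) :
    Tendsto (fun n : ℕ => ∫ x in Ω₀ \ closure Ω₁, deriv (outerCutoff n) (u x) * R x)
      atTop (𝓝 0) := by
  set Ω := Ω₀ \ closure Ω₁ with hΩ
  rw [Metric.tendsto_nhds]
  intro τ hτ
  set τ' := τ / (B + 1) with hτ'
  have hτ'0 : 0 < τ' := by positivity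
  obtain ⟨m, hm0, hm⟩ : ∃ m : ℝ, m < 0 ∧ ∀ x ∈ closure Ω, m < u x → |R x| ≤ τ' * P x := by
    have hBc : IsCompact {x ∈ closure Ω | 0 ≤ |R x| - τ' * P x} :=
      h.isCompact_closure.of_isClosed_subset
        ((hR.abs.sub (continuousOn_const.mul hP)).preimage_isClosed_of_isClosed isClosed_closure
          (isClosed_Ici (a := 0))) fun x hx => hx.1
    rcases eq_empty_or_nonempty {x ∈ closure Ω | 0 ≤ |R x| - τ' * P x} with he | hne
    · refine ⟨-1, by norm_num, fun x hx _ => le_of_lt (not_le.1 fun h' => ?_)⟩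
      exact (he ▸ (⟨hx, by linarith⟩ : x ∈ {x ∈ closure Ω | 0 ≤ |R x| - τ' * P x}) :
        x ∈ (∅ : Set E))
    · obtain ⟨y, hy, hmax⟩ := hBc.exists_isMaxOn hne (h.continuousOn.mono fun x hx => hx.1)
      refine ⟨u y, ?_, fun x hx hxm => le_of_lt (not_le.1 fun h' => ?_)⟩
      · rcases mem_frontier_of_mem_closure_ring h.isOpen_outer h.isOpen_inner hy.1 with h' | h' | h'
        · exact h.neg y h'
        · have h1 := hy.2
          rw [hR0 y hy.1 h', abs_zero] at h1
          have := mul_pos hτ'0 (hP0 y hy.1 h')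
          linarith
        · rw [h.eq_inner y h']
          linarith [h.pos]
      · exact absurd (hmax (show x ∈ {x ∈ closure Ω | 0 ≤ |R x| - τ' * P x} from
          ⟨hx, by linarith⟩)) (not_le.2 hxm)
  filter_upwards [tendsto_two_div_add_atTop.eventually_lt_const (show (0:ℝ) < -m by linarith)]
    with n hn
  have hcP : IntegrableOn (fun x => deriv (outerCutoff n) (u x) * P x) Ω :=
    h.integrableOn_of_continuousOn ((h.continuousOn_deriv_comp (contDiff_outerCutoff n)).mul hP)
  rw [dist_zero_right]
  calc ‖∫ x in Ω, deriv (outerCutoff n) (u x) * R x‖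
      ≤ ∫ x in Ω, -τ' * (deriv (outerCutoff n) (u x) * P x) := by
        refine norm_integral_le_of_norm_le (hcP.const_mul _) ?_
        refine (ae_restrict_iff' h.isOpen_ring.measurableSet).2 (ae_of_all _ fun x hx => ?_)
        have hd := deriv_outerCutoff_nonpos n (u x)
        rw [norm_mul, Real.norm_eq_abs, Real.norm_eq_abs, abs_of_nonpos hd]
        by_cases hxu : u x < -(2 / (n + 1))
        · simp [deriv_outerCutoff_eq_zero hxu]
        · have := hm x (subset_closure hx) (by linarith)
          nlinarith
    _ = τ' * -∫ x in Ω, deriv (outerCutoff n) (u x) * P x := by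
        rw [integral_const_mul]; ring
    _ ≤ τ' * B := mul_le_mul_of_nonneg_left (hPB n) hτ'0.le
    _ < τ := by
        rw [hτ', div_mul_eq_mul_div, div_lt_iff₀ (by linarith)]
        nlinarith

/-- Functions of `u` approximating `1` in the ring. -/
lemma tendsto_integral_outerCutoff (h : RingPotential Ω₀ Ω₁ U u c) {d : E → ℝ}
    (hd : IntegrableOn d (Ω₀ \ closure Ω₁)) :
    Tendsto (fun n : ℕ => ∫ x in Ω₀ \ closure Ω₁, outerCutoff n (u x) * d x)
      atTop (𝓝 (∫ x in Ω₀ \ closure Ω₁, d x)) := by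
  refine tendsto_integral_of_dominated_convergence (fun x => ‖d x‖)
    (fun n => ((((contDiff_outerCutoff n).continuous.comp_continuousOn h.continuousOn).mono
      subset_closure).aestronglyMeasurable h.isOpen_ring.measurableSet).mul
        hd.aestronglyMeasurable) hd.norm (fun n => ae_of_all _ fun x => ?_) ?_
  · rw [norm_mul]
    exact mul_le_of_le_one_left (norm_nonneg _) (abs_outerCutoff_le_one n _)
  · refine (ae_restrict_iff' h.isOpen_ring.measurableSet).2 (ae_of_all _ fun x hx => ?_)
    refine tendsto_const_nhds.congr' ?_
    filter_upwards [tendsto_two_div_add_atTop.eventually_lt_const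
      (show (0:ℝ) < -u x by linarith [h.neg x hx])] with n hn
    rw [outerCutoff_eq_one (by linarith), one_mul]

lemma volume_ring_add (h : RingPotential Ω₀ Ω₁ U u c) :
    volume.real (Ω₀ \ closure Ω₁) + volume.real Ω₁ = volume.real Ω₀ := by
  have h1 : volume.real Ω₁ = volume.real (closure Ω₁) := measureReal_congr
    (closure_ae_eq_of_null_frontier (h.convex_inner.addHaar_frontier volume)).symm
  rw [h1, measureReal_sdiff h.closure_inner_subset isClosed_closure.measurableSet
    h.isBounded_outer.measure_lt_top.ne, sub_add_cancel]

end RingPotential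

end Ring

section Flux

variable {N : ℕ}

local notation "E" => EuclideanSpace ℝ (Fin N)

/-- The flux `g(|∇u|²) ∇u`. -/
def fluxField (g : ℝ → ℝ) (u : EuclideanSpace ℝ (Fin N) → ℝ) (x : EuclideanSpace ℝ (Fin N)) :
    EuclideanSpace ℝ (Fin N) :=
  g (‖gradient u x‖ ^ 2) • gradient u x

lemma inner_gradient (u : E → ℝ) (x z : E) : inner ℝ (gradient u x) z = fderiv ℝ u x z := by
  simp [gradient]

lemma gradient_apply (u : E → ℝ) (x : E) (i : Fin N) : gradient u x i = fderiv ℝ u x (eb N i) := by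
  rw [← inner_gradient, eb, EuclideanSpace.inner_single_right]
  simp

lemma fderiv_fluxField (g : ℝ → ℝ) (u : E → ℝ) (x : E) :
    fderiv ℝ u x (fluxField g u x) = ‖gradient u x‖ * fluxMod g ‖gradient u x‖ := by
  rw [fluxField, map_smul, ← inner_gradient, real_inner_self_eq_norm_sq, fluxMod, smul_eq_mul]
  ring

lemma divergence_fluxField (g : ℝ → ℝ) (u : E → ℝ) (x : E) :
    divergence (fluxField g u) x
      = ∑ i, fderiv ℝ (fun y => g (‖gradient u y‖ ^ 2) * fderiv ℝ u y (eb N i)) x (eb N i) := by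
  simp [divergence, fluxField, gradient_apply]

lemma contDiffOn_gradient {u : E → ℝ} {U : Set E} (hU : IsOpen U) (hu : ContDiffOn ℝ 3 u U) :
    ContDiffOn ℝ 2 (gradient u) U :=
  (InnerProductSpace.toDual ℝ E).symm.contDiff.comp_contDiffOn
    (hu.fderiv_of_isOpen hU (by norm_num))

lemma Cond24.norm_fluxField {g : ℝ → ℝ} (hg : Cond24 g) (u : E → ℝ) (x : E) :
    ‖fluxField g u x‖ = fluxMod g ‖gradient u x‖ := by
  rw [← abs_of_nonneg (hg.fluxMod_nonneg (norm_nonneg (gradient u x))), fluxField, norm_smul,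
    fluxMod, abs_mul, abs_norm, Real.norm_eq_abs]

lemma Cond24.continuousOn_fluxField {g : ℝ → ℝ} (hg : Cond24 g) {u : E → ℝ} {s : Set E}
    (hu : ContinuousOn (gradient u) s) : ContinuousOn (fluxField g u) s := by
  intro x hx
  by_cases h0 : gradient u x = 0
  · have hW0 : fluxField g u x = 0 := by simp [fluxField, h0]
    rw [ContinuousWithinAt, hW0, tendsto_zero_iff_norm_tendsto_zero]
    simp only [hg.norm_fluxField]
    have h := hg.continuousOn_fluxMod.comp hu.norm (fun y _ => norm_nonneg _) x hx
    simpa [ContinuousWithinAt, Function.comp_def, h0, fluxMod] using h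
  · have hpos : 0 < ‖gradient u x‖ ^ 2 := by positivity
    have hn : ContinuousWithinAt (fun y => ‖gradient u y‖ ^ 2) s x := (hu x hx).norm.pow 2
    exact (ContinuousAt.comp_continuousWithinAt (f := fun y => ‖gradient u y‖ ^ 2)
      (hg.contDiffAt hpos).continuousAt hn).smul (hu x hx)

lemma Cond24.contDiffAt_fluxField {g : ℝ → ℝ} (hg : Cond24 g) {u : E → ℝ} {x : E}
    (hu : ContDiffAt ℝ 2 (gradient u) x) (h0 : gradient u x ≠ 0) :
    ContDiffAt ℝ 1 (fluxField g u) x := by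
  have hpos : 0 < ‖gradient u x‖ ^ 2 := by positivity
  have hu1 : ContDiffAt ℝ 1 (gradient u) x := hu.of_le (by norm_num)
  exact (ContDiffAt.comp x ((hg.contDiffAt hpos).of_le (by norm_num))
    (hu1.norm_sq ℝ)).smul hu1

lemma Cond24.contDiffAt_fluxPrim {g : ℝ → ℝ} (hg : Cond24 g) {t : ℝ} (ht : 0 < t) :
    ContDiffAt ℝ 1 (fluxPrim g) t := by
  have h : ContDiffOn ℝ 1 (fluxPrim g) (Ioi 0) := by
    rw [show (1 : WithTop ℕ∞) = 0 + 1 by norm_num, contDiffOn_succ_iff_deriv_of_isOpen isOpen_Ioi]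
    refine ⟨fun s hs => (hg.hasDerivAt_fluxPrim hs).differentiableAt.differentiableWithinAt,
      by simp, ?_⟩
    rw [contDiffOn_zero]
    exact (hg.continuousOn_fluxMod.mono Ioi_subset_Ici_self).congr fun s hs =>
      (hg.hasDerivAt_fluxPrim hs).deriv
  exact h.contDiffAt (Ioi_mem_nhds ht)

lemma Cond24.fderiv_fluxPrim_norm_gradient {g : ℝ → ℝ} (hg : Cond24 g) {u : E → ℝ} {x : E}
    (hu : DifferentiableAt ℝ (fderiv ℝ u) x) (h0 : gradient u x ≠ 0) (z : E) :
    fderiv ℝ (fun y => fluxPrim g ‖gradient u y‖) x z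
      = fderiv ℝ (fderiv ℝ u) x z (fluxField g u x) := by
  have hq : 0 < ‖gradient u x‖ := norm_pos_iff.2 h0
  have hG : HasFDerivAt (gradient u) _ x :=
    (InnerProductSpace.toDual ℝ E).symm.toContinuousLinearEquiv.hasFDerivAt.comp x hu.hasFDerivAt
  have hs := hG.norm_sq.sqrt (by positivity)
  simp only [Real.sqrt_sq (norm_nonneg _)] at hs
  have hc : HasFDerivAt (fun y => fluxPrim g ‖gradient u y‖) _ x :=
    HasDerivAt.comp_hasFDerivAt (f := fun y => ‖gradient u y‖) x (hg.hasDerivAt_fluxPrim hq) hs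
  rw [hc.fderiv]
  simp only [smul_apply, ContinuousLinearMap.comp_apply, innerSL_apply_apply,
    smul_eq_mul, nsmul_eq_mul]
  have hin : inner ℝ (gradient u x)
      ((InnerProductSpace.toDual ℝ E).symm (fderiv ℝ (fderiv ℝ u) x z))
        = fderiv ℝ (fderiv ℝ u) x z (gradient u x) := by
    rw [real_inner_comm]
    exact InnerProductSpace.toDual_symm_apply
  simp only [ContinuousLinearEquiv.coe_coe, LinearIsometryEquiv.coe_toContinuousLinearEquiv, hin,
    fluxField, map_smul, fluxMod, smul_eq_mul]
  field_simp
  simp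

/-- The field whose divergence, for a solution of the overdetermined problem, is
`∫₀^q s G(s²) ds - u - c N`. -/
def pohozaevField (g : ℝ → ℝ) (u : EuclideanSpace ℝ (Fin N) → ℝ) (c : ℝ)
    (x : EuclideanSpace ℝ (Fin N)) : EuclideanSpace ℝ (Fin N) :=
  ((1 - 1 / N) * u x + 1 / N * fderiv ℝ u x x) • fluxField g u x
    - (u x + 1 / N * fluxPrim g ‖gradient u x‖ + c) • x

lemma Cond24.divergence_pohozaevField {g : ℝ → ℝ} (hg : Cond24 g) (hN : N ≠ 0) {u : E → ℝ} (c : ℝ)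
    {x : E} (hu : ContDiffAt ℝ 3 u x) (hG : ContDiffAt ℝ 2 (gradient u) x)
    (h0 : gradient u x ≠ 0) (hdiv : divergence (fluxField g u) x = N) :
    divergence (pohozaevField g u c) x
      = (‖gradient u x‖ * fluxMod g ‖gradient u x‖ - fluxPrim g ‖gradient u x‖) - u x - c * N := by
  have hNr : (N : ℝ) ≠ 0 := by exact_mod_cast hN
  have hq : 0 < ‖gradient u x‖ := norm_pos_iff.2 h0
  have hud : HasFDerivAt u (fderiv ℝ u x) x := (hu.differentiableAt (by norm_num)).hasFDerivAt
  have hu2 : DifferentiableAt ℝ (fderiv ℝ u) x :=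
    (hu.fderiv_right (m := 2) (by norm_num)).differentiableAt (by norm_num)
  have hW := (hg.contDiffAt_fluxField hG h0).differentiableAt one_ne_zero
  have ha := (hud.const_mul (1 - 1 / (N:ℝ))).add
    ((hu2.hasFDerivAt.clm_apply (hasFDerivAt_id x)).const_mul (1 / (N:ℝ)))
  have hF : DifferentiableAt ℝ (fun y => fluxPrim g ‖gradient u y‖) x :=
    (ContDiffAt.comp x (hg.contDiffAt_fluxPrim hq)
      ((hG.of_le (by norm_num)).norm ℝ h0)).differentiableAt one_ne_zero
  have hb := (hud.add (hF.hasFDerivAt.const_mul (1 / (N:ℝ)))).add_const c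
  have hsymm : ∀ v w, fderiv ℝ (fderiv ℝ u) x v w = fderiv ℝ (fderiv ℝ u) x w v :=
    fun v w => (hu.isSymmSndFDerivAt (by simp; norm_num)).eq v w
  set a : E → ℝ := fun y => (1 - 1 / (N:ℝ)) * u y + 1 / N * fderiv ℝ u y y with hadef
  set b : E → ℝ := fun y => u y + 1 / (N:ℝ) * fluxPrim g ‖gradient u y‖ + c with hbdef
  have ha' : HasFDerivAt a _ x := ha
  have hb' : HasFDerivAt b _ x := hb
  have hdef : pohozaevField g u c = fun y => a y • fluxField g u y - b y • y := rfl
  rw [hdef, divergence_sub (Z := fun y => a y • fluxField g u y) (Y := fun y => b y • y)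
    (ha'.differentiableAt.smul hW) (hb'.differentiableAt.smul differentiableAt_id),
    divergence_smul ha'.differentiableAt hW,
    divergence_smul (Z := fun y => y) hb'.differentiableAt differentiableAt_id, divergence_id, hdiv,
    ha'.fderiv, hb'.fderiv]
  simp only [add_apply, smul_apply, ContinuousLinearMap.comp_apply,
    ContinuousLinearMap.flip_apply, ContinuousLinearMap.id_apply, id,
    smul_eq_mul, hg.fderiv_fluxPrim_norm_gradient hu2 h0, fderiv_fluxField,
    hsymm x (fluxField g u x), hadef, hbdef]
  field_simp
  ring

lemma Cond24.contDiffAt_pohozaevField {g : ℝ → ℝ} (hg : Cond24 g) {u : E → ℝ} (c : ℝ) {x : E}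
    (hu : ContDiffAt ℝ 3 u x) (hG : ContDiffAt ℝ 2 (gradient u) x) (h0 : gradient u x ≠ 0) :
    ContDiffAt ℝ 1 (pohozaevField g u c) x := by
  have hq : 0 < ‖gradient u x‖ := norm_pos_iff.2 h0
  have hu1 : ContDiffAt ℝ 1 u x := hu.of_le (by norm_num)
  have hdu : ContDiffAt ℝ 1 (fun y => fderiv ℝ u y y) x :=
    (hu.fderiv_right (m := 1) (by norm_num)).clm_apply contDiffAt_id
  have hF : ContDiffAt ℝ 1 (fun y => fluxPrim g ‖gradient u y‖) x :=
    ContDiffAt.comp x (hg.contDiffAt_fluxPrim hq)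
      ((hG.of_le (by norm_num)).norm ℝ h0)
  exact (((contDiffAt_const.mul hu1).add (contDiffAt_const.mul hdu)).smul
    (hg.contDiffAt_fluxField hG h0)).sub
    (((hu1.add (contDiffAt_const.mul hF)).add contDiffAt_const).smul contDiffAt_id)

lemma Cond24.continuousOn_pohozaevField {g : ℝ → ℝ} (hg : Cond24 g) {u : E → ℝ} (c : ℝ) {s : Set E}
    (hu : ContinuousOn u s) (hdu : ContinuousOn (fderiv ℝ u) s)
    (hG : ContinuousOn (gradient u) s) : ContinuousOn (pohozaevField g u c) s := by
  have hF : ContinuousOn (fun y => fluxPrim g ‖gradient u y‖) s :=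
    hg.continuousOn_fluxPrim.comp hG.norm fun y _ => norm_nonneg _
  exact (((continuousOn_const.mul hu).add
    (continuousOn_const.mul (hdu.clm_apply continuousOn_id))).smul
    (hg.continuousOn_fluxField hG)).sub
    (((hu.add (continuousOn_const.mul hF)).add continuousOn_const).smul continuousOn_id)

lemma fderiv_pohozaevField (g : ℝ → ℝ) (u : E → ℝ) (c : ℝ) {x : E} (hx : u x = 0) :
    fderiv ℝ u x (pohozaevField g u c x)
      = ((‖gradient u x‖ * fluxMod g ‖gradient u x‖ - fluxPrim g ‖gradient u x‖) / N - c)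
        * fderiv ℝ u x x := by
  rw [pohozaevField, map_sub, map_smul, map_smul, fderiv_fluxField, hx, smul_eq_mul, smul_eq_mul]
  ring

end Flux
/-- Integral identity (3.18) in the proof of the paper's Theorem 3.1: for
`v(x) = ∫₀^{q(x)} s G(s²) ds − u(x)` one has
`∫_Ω v = |Ω₀| · ∫₀^{q₀} s G(s²) ds − c₁ N |Ω₁|`. -/
theorem stmt13 (N : ℕ) (hN : 2 ≤ N) (g : ℝ → ℝ) (hg : Cond24 g)
    (Ω₀ Ω₁ : Set (EuclideanSpace ℝ (Fin N)))
    (hΩ₀open : IsOpen Ω₀) (hΩ₁open : IsOpen Ω₁)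
    (hΩ₀bdd : Bornology.IsBounded Ω₀) (hΩ₁bdd : Bornology.IsBounded Ω₁)
    (hΩ₀conv : Convex ℝ Ω₀) (hΩ₁conv : Convex ℝ Ω₁)
    (hΩ₀ne : Ω₀.Nonempty) (hΩ₁ne : Ω₁.Nonempty)
    (hsub : closure Ω₁ ⊆ Ω₀)
    (q₀ c₁ : ℝ) (hq₀ : 0 < q₀) (hc₁ : 0 < c₁)
    (u : EuclideanSpace ℝ (Fin N) → ℝ)
    (U : Set (EuclideanSpace ℝ (Fin N))) (hU : IsOpen U)
    (hUsub : closure (Ω₀ \ closure Ω₁) ⊆ U) (hu : ContDiffOn ℝ 3 u U)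
    (hgrad : ∀ x ∈ Ω₀ \ closure Ω₁, gradient u x ≠ 0)
    (hpde : ∀ x ∈ Ω₀ \ closure Ω₁,
      ∑ i, fderiv ℝ (fun y => g (‖gradient u y‖ ^ 2) * fderiv ℝ u y (eb N i)) x (eb N i)
        = (N : ℝ))
    (hu0 : ∀ x ∈ frontier Ω₀, u x = 0)
    (hq0 : ∀ x ∈ frontier Ω₀, ‖gradient u x‖ = q₀)
    (hu1 : ∀ x ∈ frontier Ω₁, u x = -c₁)
    (hq1 : ∀ x ∈ frontier Ω₁, gradient u x = 0) :
    ∫ x in Ω₀ \ closure Ω₁,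
        ((∫ s in (0:ℝ)..‖gradient u x‖, s * Gfun g (s ^ 2)) - u x)
      = (volume Ω₀).toReal * (∫ s in (0:ℝ)..q₀, s * Gfun g (s ^ 2))
        - c₁ * N * (volume Ω₁).toReal := by
  have hcont : ContinuousOn u (closure (Ω₀ \ closure Ω₁)) := hu.continuousOn.mono hUsub
  have h : RingPotential Ω₀ Ω₁ U u c₁ :=
    ⟨hΩ₀open, hΩ₁open, hΩ₀bdd, hΩ₁conv, hΩ₁ne, hsub, hU, hUsub, hu, hc₁, hu0, hu1,
      neg_of_gradient_ne_zero hΩ₀open hΩ₁open hΩ₀bdd hcont hc₁ hu0 hu1 hgrad⟩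
  have hN0 : N ≠ 0 := by omega
  have hNr : (N : ℝ) ≠ 0 := by exact_mod_cast hN0
  have hmeas : MeasurableSet (Ω₀ \ closure Ω₁) := h.isOpen_ring.measurableSet
  have hGU := contDiffOn_gradient hU hu
  have hGc : ContinuousOn (gradient u) (closure (Ω₀ \ closure Ω₁)) := hGU.continuousOn.mono hUsub
  have hu3 : ∀ x ∈ Ω₀ \ closure Ω₁, ContDiffAt ℝ 3 u x := fun x hx =>
    hu.contDiffAt (hU.mem_nhds (hUsub (subset_closure hx)))
  have hG2 : ∀ x ∈ Ω₀ \ closure Ω₁, ContDiffAt ℝ 2 (gradient u) x := fun x hx =>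
    hGU.contDiffAt (hU.mem_nhds (hUsub (subset_closure hx)))
  have hdivW : ∀ x ∈ Ω₀ \ closure Ω₁, divergence (fluxField g u) x = N := fun x hx =>
    (divergence_fluxField g u x).trans (hpde x hx)
  have hWc := hg.continuousOn_fluxField hGc
  have hZc := hg.continuousOn_pohozaevField c₁ hcont h.continuousOn_fderiv hGc
  have hW1 : ContDiffOn ℝ 1 (fluxField g u) (Ω₀ \ closure Ω₁) := fun x hx =>
    (hg.contDiffAt_fluxField (hG2 x hx) (hgrad x hx)).contDiffWithinAt
  have hZ1 : ContDiffOn ℝ 1 (pohozaevField g u c₁) (Ω₀ \ closure Ω₁) := fun x hx =>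
    (hg.contDiffAt_pohozaevField c₁ (hu3 x hx) (hG2 x hx) (hgrad x hx)).contDiffWithinAt
  have hW0 : ∀ x ∈ frontier Ω₁, fluxField g u x = 0 := fun x hx => by
    simp [fluxField, hq1 x hx]
  have hZ0 : ∀ x ∈ frontier Ω₁, pohozaevField g u c₁ x = 0 := fun x hx => by
    simp [pohozaevField, hW0 x hx, hq1 x hx, hu1 x hx, fluxPrim]
  set v : EuclideanSpace ℝ (Fin N) → ℝ := fun x =>
    (∫ s in (0:ℝ)..‖gradient u x‖, s * Gfun g (s ^ 2)) - u x with hv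
  have hdivZ : ∀ x ∈ Ω₀ \ closure Ω₁, divergence (pohozaevField g u c₁) x = v x - c₁ * N :=
    fun x hx => by
      rw [hg.divergence_pohozaevField hN0 c₁ (hu3 x hx) (hG2 x hx) (hgrad x hx) (hdivW x hx), hv]
      simp only [hg.integral_Gfun (norm_nonneg _)]
  have hvc : ContinuousOn v (closure (Ω₀ \ closure Ω₁)) := by
    simp only [hv, hg.integral_Gfun (norm_nonneg _)]
    exact ((hGc.norm.mul (hg.continuousOn_fluxMod.comp hGc.norm fun y _ => norm_nonneg _)).sub
      (hg.continuousOn_fluxPrim.comp hGc.norm fun y _ => norm_nonneg _)).sub hcont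
  have hvi : IntegrableOn v (Ω₀ \ closure Ω₁) := h.integrableOn_of_continuousOn hvc
  have hconst : ∀ a : ℝ, IntegrableOn (fun _ => a) (Ω₀ \ closure Ω₁) := fun a =>
    h.integrableOn_of_continuousOn continuousOn_const
  have hWi : IntegrableOn (divergence (fluxField g u)) (Ω₀ \ closure Ω₁) :=
    (hconst N).congr_fun (fun x hx => (hdivW x hx).symm) hmeas
  have hZi : IntegrableOn (divergence (pohozaevField g u c₁)) (Ω₀ \ closure Ω₁) :=
    (hvi.sub (hconst (c₁ * N))).congr_fun (fun x hx => (hdivZ x hx).symm) hmeas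
  have hδ : ∀ n : ℕ, (0:ℝ) < 1 / (n + 1) := fun n => by positivity
  set κ : ℝ := (∫ s in (0:ℝ)..q₀, s * Gfun g (s ^ 2)) / N - c₁ with hκ
  set R : EuclideanSpace ℝ (Fin N) → ℝ := fun x =>
    fderiv ℝ u x (pohozaevField g u c₁ x) - κ * fderiv ℝ u x x with hR
  have hXc : ContinuousOn (fun x => fderiv ℝ u x x) (closure (Ω₀ \ closure Ω₁)) :=
    h.continuousOn_fderiv.clm_apply continuousOn_id
  have hRc : ContinuousOn R (closure (Ω₀ \ closure Ω₁)) :=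
    (h.continuousOn_fderiv.clm_apply hZc).sub (continuousOn_const.mul hXc)
  have hlimR : Tendsto (fun n : ℕ => ∫ x in Ω₀ \ closure Ω₁, deriv (outerCutoff n) (u x) * R x)
      atTop (𝓝 0) := by
    refine h.tendsto_integral_deriv_outerCutoff hRc (h.continuousOn_fderiv.clm_apply hWc)
      (fun x _ hx => ?_) (fun x _ hx => ?_) (B := ∫ x in Ω₀ \ closure Ω₁, (N : ℝ))
      (integral_nonneg fun x => Nat.cast_nonneg N) (fun n => ?_)
    · rw [hR]
      simp only [fderiv_pohozaevField g u c₁ (hu0 x hx), hq0 x hx, hκ, hg.integral_Gfun hq₀.le,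
        sub_self]
    · rw [fderiv_fluxField, hq0 x hx]
      exact mul_pos hq₀ (hg.fluxMod_pos hq₀)
    · rw [← h.integral_comp_mul_divergence (contDiff_outerCutoff n) (abs_outerCutoff_le_one n)
        (hδ n) (fun t => outerCutoff_eq_zero) hWc hW1 hW0 hWi]
      refine setIntegral_mono_on ?_ (hconst N) hmeas fun x hx => ?_
      · exact hWi.bdd_mul (c := 1) ((((contDiff_outerCutoff n).continuous.comp_continuousOn
          hcont).mono subset_closure).aestronglyMeasurable hmeas)
          (ae_of_all _ fun x => abs_outerCutoff_le_one n _)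
      · rw [hdivW x hx]
        exact mul_le_of_le_one_left (Nat.cast_nonneg N) (le_of_abs_le (abs_outerCutoff_le_one n _))
  have hev : ∀ᶠ n : ℕ in atTop,
      ∫ x in Ω₀ \ closure Ω₁, outerCutoff n (u x) * divergence (pohozaevField g u c₁) x
        = -(∫ x in Ω₀ \ closure Ω₁, deriv (outerCutoff n) (u x) * R x)
          + κ * (N * (∫ x in Ω₀ \ closure Ω₁, outerCutoff n (u x) * 1)
            + N * volume.real Ω₁) := by
    filter_upwards [tendsto_two_div_add_atTop.eventually_lt_const hc₁] with n hn
    have hη := contDiff_outerCutoff n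
    have hη' := h.continuousOn_deriv_comp hη
    have hRi : IntegrableOn (fun x => deriv (outerCutoff n) (u x) * R x) (Ω₀ \ closure Ω₁) :=
      h.integrableOn_of_continuousOn (hη'.mul hRc)
    have hXi : IntegrableOn (fun x => κ * (deriv (outerCutoff n) (u x) * fderiv ℝ u x x))
        (Ω₀ \ closure Ω₁) :=
      h.integrableOn_of_continuousOn (continuousOn_const.mul (hη'.mul hXc))
    rw [h.integral_comp_mul_divergence hη (abs_outerCutoff_le_one n) (hδ n)
      (fun t => outerCutoff_eq_zero) hZc hZ1 hZ0 hZi]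
    simp only [mul_one]
    rw [h.integral_comp_add_volume hη (hδ n) (fun t => outerCutoff_eq_zero) hn
      (fun t => outerCutoff_eq_one), mul_neg, ← neg_add, ← integral_const_mul,
      ← integral_add hRi hXi]
    congr 2
    ext x
    rw [hR]
    ring
  have hlim := tendsto_nhds_unique ((h.tendsto_integral_outerCutoff hZi).congr' hev)
    (hlimR.neg.add (((h.tendsto_integral_outerCutoff (hconst 1)).const_mul (N:ℝ)).add_const
      (N * volume.real Ω₁) |>.const_mul κ))
  rw [setIntegral_congr_fun hmeas hdivZ, integral_sub hvi (hconst _), setIntegral_const,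
    setIntegral_const, smul_eq_mul, smul_eq_mul] at hlim
  have hvol := h.volume_ring_add
  rw [← measureReal_def, ← measureReal_def, ← hvol]
  have hκN : κ * N = (∫ s in (0:ℝ)..q₀, s * Gfun g (s ^ 2)) - c₁ * N := by
    rw [hκ, sub_mul, div_mul_cancel₀ _ hNr]
  linear_combination hlim + (volume.real (Ω₀ \ closure Ω₁) + volume.real Ω₁) * hκN

end
end

section
/- Assume g satisfies conditions (2.4) and let N ≥ 2. For each α > 0 and each s ≥ 0, let ψ_α(s) denote the unique number ψ ≥ α satisfying g(s²)s = (1 − α^N ψ^{−N}) ψ (such ψ exists and is unique since ψ ↦ ψ − α^N ψ^{1−N} is a strictly increasing bijection from [α,∞) onto [0,∞)); in particular ψ_α(0) = α. Then ψ_α is differentiable on (0,∞) with ψ_α'(s) = G(s²) ψ_α(s)^N / (ψ_α(s)^N + (N−1) α^N); moreover, for each fixed s > 0, the map α ↦ s ψ_α'(s) is decreasing in α, and s ψ_α'(s) → (1/N) s G(s²) as α → ∞. -/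
open Set Filter

noncomputable section

/-- The map `x ↦ (1 - αᴺ x⁻ᴺ) x`, whose inverse on `[α, ∞)` defines `ψ_α`. -/
def profileMap (N : ℕ) (α x : ℝ) : ℝ := (1 - α ^ N * x ^ (-(N : ℤ))) * x

lemma profileMap_eq_div (N : ℕ) (α x : ℝ) : profileMap N α x = (1 - (α / x) ^ N) * x := by
  rw [profileMap, zpow_neg, zpow_natCast, div_pow, div_eq_mul_inv]

lemma profileMap_self (N : ℕ) {α : ℝ} (hα : 0 < α) : profileMap N α α = 0 := by
  simp [profileMap_eq_div, hα.ne']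

lemma profileMap_eq_mul (N : ℕ) {α : ℝ} (hα : 0 < α) (x : ℝ) :
    profileMap N α x = α * profileMap N 1 (x / α) := by
  rw [profileMap_eq_div, profileMap_eq_div, one_div_div]
  field_simp

lemma strictMonoOn_profileMap {N : ℕ} (hN : N ≠ 0) {α : ℝ} (hα : 0 < α) :
    StrictMonoOn (profileMap N α) (Ici α) := by
  intro x hx y hy hxy
  rw [mem_Ici] at hx hy
  have hx0 : 0 < x := hα.trans_le hx
  have hy0 : 0 < y := hx0.trans hxy
  have h1 : (α / x) ^ N ≤ 1 := pow_le_one₀ (by positivity) ((div_le_one hx0).2 hx)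
  have h2 : (α / y) ^ N < (α / x) ^ N :=
    pow_lt_pow_left₀ (div_lt_div_of_pos_left hα hx0 hxy) (by positivity) hN
  rw [profileMap_eq_div, profileMap_eq_div]
  nlinarith

lemma hasStrictDerivAt_profileMap (N : ℕ) (α : ℝ) {x : ℝ} (hx : 0 < x) :
    HasStrictDerivAt (profileMap N α) ((x ^ N + ((N : ℝ) - 1) * α ^ N) / x ^ N) x := by
  have h := (((hasStrictDerivAt_zpow (-(N : ℤ)) x (Or.inl hx.ne')).const_mul (α ^ N)).const_sub
    1).mul (hasStrictDerivAt_id x)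
  refine h.congr_deriv ?_
  rw [zpow_sub_one₀ hx.ne', zpow_neg, zpow_natCast]
  push_cast
  simp only [id]
  field_simp
  ring

lemma sub_one_le_profileMap_one {N : ℕ} (hN : N ≠ 0) {x : ℝ} (hx : 1 ≤ x) :
    x - 1 ≤ profileMap N 1 x := by
  have hx0 : 0 < x := one_pos.trans_le hx
  have h : (1 / x) ^ N ≤ 1 / x :=
    pow_le_of_le_one (by positivity) ((div_le_one hx0).2 hx) hN
  have h' : (1 / x) ^ N * x ≤ 1 / x * x := mul_le_mul_of_nonneg_right h hx0.le
  rw [one_div_mul_cancel hx0.ne'] at h'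
  rw [profileMap_eq_div]
  linarith

lemma hasDerivAt_comp_sq_mul {g : ℝ → ℝ} (hg : ContDiffOn ℝ (⊤ : ℕ∞) g (Ioi 0)) {s : ℝ}
    (hs : 0 < s) : HasDerivAt (fun t : ℝ => g (t ^ 2) * t) (Gfun g (s ^ 2)) s := by
  have hs2 : 0 < s ^ 2 := by positivity
  have hd : HasDerivAt g (deriv g (s ^ 2)) (s ^ 2) :=
    ((hg.differentiableOn (by simp)).differentiableAt (Ioi_mem_nhds hs2)).hasDerivAt
  refine ((hd.comp (h := fun t : ℝ => t ^ 2) s (hasDerivAt_pow 2 s)).mul (hasDerivAt_id s)).congr_deriv ?_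
  simp only [Gfun, id, Function.comp]
  push_cast
  ring

/-- A solution `u` of `profileMap N α (u t) = f t` with values in `[α, ∞)` is differentiable
wherever `f` is differentiable and positive. -/
lemma hasDerivAt_of_profileMap_eq {N : ℕ} (hN : N ≠ 0) {α : ℝ} (hα : 0 < α) {f u : ℝ → ℝ}
    {f' s : ℝ} (hf : HasDerivAt f f' s) (hfs : 0 < f s)
    (hu : ∀ᶠ t in nhds s, α ≤ u t ∧ profileMap N α (u t) = f t) :
    HasDerivAt u (f' * u s ^ N / (u s ^ N + ((N : ℝ) - 1) * α ^ N)) s := by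
  obtain ⟨hle, heq⟩ := hu.self_of_nhds
  have hlt : α < u s := by
    refine lt_of_le_of_ne hle fun h => ?_
    rw [← h, profileMap_self N hα] at heq
    exact hfs.ne heq
  have hpos : 0 < u s := hα.trans hlt
  have hN1 : (1 : ℝ) ≤ N := by exact_mod_cast Nat.one_le_iff_ne_zero.2 hN
  have hden : 0 < u s ^ N + ((N : ℝ) - 1) * α ^ N :=
    add_pos_of_pos_of_nonneg (by positivity) (mul_nonneg (by linarith) (by positivity))
  have hs := hasStrictDerivAt_profileMap N α hpos
  have hc : (u s ^ N + ((N : ℝ) - 1) * α ^ N) / u s ^ N ≠ 0 := by positivity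
  set k := hs.localInverse _ _ _ hc
  have hkd : HasStrictDerivAt k _ (profileMap N α (u s)) := hs.to_localInverse hc
  have hks : k (profileMap N α (u s)) = u s :=
    (hs.hasStrictFDerivAt_equiv hc).localInverse_apply_image
  have hright : ∀ᶠ y in nhds (profileMap N α (u s)), profileMap N α (k y) = y :=
    (hs.hasStrictFDerivAt_equiv hc).eventually_right_inverse
  rw [heq] at hkd hks hright
  have hcomp : HasDerivAt (k ∘ f) _ s := hkd.hasDerivAt.comp s hf
  have hev : ∀ᶠ t in nhds s, α < (k ∘ f) t :=
    hcomp.continuousAt.eventually (lt_mem_nhds (by simpa [hks] using hlt))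
  refine (hcomp.congr_of_eventuallyEq ?_).congr_deriv ?_
  · filter_upwards [hu, hev, hf.continuousAt.eventually hright] with t ht htk hr
    exact (strictMonoOn_profileMap hN hα).injOn ht.1 htk.le (ht.2.trans hr.symm)
  · rw [inv_div]
    ring

/-- Formula (3.8) together with the monotonicity and limit claims used in the proof
of the paper's Theorem 3.1: with `ψ_α(s)` (here `Ψ α s`) the unique `ψ ≥ α`
satisfying `g(s²)s = (1 − αᴺ ψ^{−N}) ψ`, one has `ψ_α(0) = α`,
`ψ_α'(s) = G(s²) ψ_αᴺ / (ψ_αᴺ + (N−1)αᴺ)` on `(0,∞)`; moreover for fixed `s > 0` the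
map `α ↦ s ψ_α'(s)` is decreasing and `s ψ_α'(s) → (1/N) s G(s²)` as `α → ∞`. -/
theorem stmt14 (N : ℕ) (hN : 2 ≤ N) (g : ℝ → ℝ) (hg : Cond24 g)
    (Ψ : ℝ → ℝ → ℝ)
    (hΨ : ∀ α > (0:ℝ), ∀ s ≥ (0:ℝ), α ≤ Ψ α s ∧
      g (s ^ 2) * s = (1 - α ^ N * (Ψ α s) ^ (-(N : ℤ))) * Ψ α s) :
    (∀ α > (0:ℝ), Ψ α 0 = α) ∧
    (∀ α > (0:ℝ), ∀ s > (0:ℝ),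
      HasDerivAt (Ψ α)
        (Gfun g (s ^ 2) * (Ψ α s) ^ N / ((Ψ α s) ^ N + ((N : ℝ) - 1) * α ^ N)) s) ∧
    (∀ s > (0:ℝ), ∀ α β : ℝ, 0 < α → α ≤ β →
      s * deriv (Ψ β) s ≤ s * deriv (Ψ α) s) ∧
    (∀ s > (0:ℝ),
      Tendsto (fun α : ℝ => s * deriv (Ψ α) s) atTop
        (nhds ((1 / N : ℝ) * (s * Gfun g (s ^ 2))))) := by
  have hN0 : N ≠ 0 := by omega
  have hN1 : (1 : ℝ) ≤ N := by exact_mod_cast (by omega : 1 ≤ N)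
  obtain ⟨hsm, hgpos, -, -, hG⟩ := hg
  have hderiv : ∀ α > (0 : ℝ), ∀ s > (0 : ℝ), HasDerivAt (Ψ α)
      (Gfun g (s ^ 2) * (Ψ α s) ^ N / ((Ψ α s) ^ N + ((N : ℝ) - 1) * α ^ N)) s := by
    intro α hα s hs
    refine hasDerivAt_of_profileMap_eq hN0 hα (hasDerivAt_comp_sq_mul hsm hs)
      (mul_pos (hgpos _ (by positivity)) hs) ?_
    filter_upwards [Ioi_mem_nhds hs] with t ht
    exact ⟨(hΨ α hα t (le_of_lt ht)).1, (hΨ α hα t (le_of_lt ht)).2.symm⟩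
  have hone : ∀ α > (0 : ℝ), ∀ s > (0 : ℝ), 1 ≤ Ψ α s / α := fun α hα s hs =>
    (one_le_div hα).2 (hΨ α hα s hs.le).1
  have hscale : ∀ α > (0 : ℝ), ∀ s > (0 : ℝ),
      profileMap N 1 (Ψ α s / α) = g (s ^ 2) * s / α := by
    intro α hα s hs
    rw [eq_div_iff hα.ne', mul_comm, ← profileMap_eq_mul N hα]
    exact (hΨ α hα s hs.le).2.symm
  have hform : ∀ α > (0 : ℝ), ∀ s > (0 : ℝ), s * deriv (Ψ α) s =
      s * Gfun g (s ^ 2) / (1 + ((N : ℝ) - 1) * ((Ψ α s / α)⁻¹) ^ N) := by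
    intro α hα s hs
    have hp : 0 < Ψ α s := hα.trans_le (hΨ α hα s hs.le).1
    have hn : (0 : ℝ) ≤ N - 1 := by linarith
    rw [(hderiv α hα s hs).deriv, inv_div, div_pow]
    have h1 : Ψ α s ^ N + ((N : ℝ) - 1) * α ^ N ≠ 0 := by positivity
    have h2 : 1 + ((N : ℝ) - 1) * (α ^ N / Ψ α s ^ N) ≠ 0 := by positivity
    rw [← mul_div_assoc, div_eq_div_iff h1 h2]
    field_simp
  refine ⟨fun α hα => ?_, hderiv, fun s hs α β hα hαβ => ?_, fun s hs => ?_⟩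
  · obtain ⟨hle, heq⟩ := hΨ α hα 0 le_rfl
    refine (strictMonoOn_profileMap hN0 hα).injOn hle self_mem_Ici ?_
    rw [profileMap_self N hα, profileMap, ← heq, mul_zero]
  · have hβ : 0 < β := hα.trans_le hαβ
    have hf : 0 ≤ g (s ^ 2) * s := (mul_pos (hgpos _ (by positivity)) hs).le
    have hGs := hG (s ^ 2) (by positivity)
    have hn : (0 : ℝ) ≤ N - 1 := by linarith
    have h1 := hone α hα s hs
    have h2 := hone β hβ s hs
    have hle : Ψ β s / β ≤ Ψ α s / α := by
      refine ((strictMonoOn_profileMap hN0 one_pos).le_iff_le h2 h1).1 ?_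
      rw [hscale α hα s hs, hscale β hβ s hs]
      exact div_le_div_of_nonneg_left hf hα hαβ
    have h3 : 0 < Ψ β s / β := one_pos.trans_le h2
    have h4 : 0 < Ψ α s / α := one_pos.trans_le h1
    rw [hform α hα s hs, hform β hβ s hs]
    gcongr
  · have hq : Tendsto (fun α : ℝ => Ψ α s / α) atTop (nhds 1) := by
      have hlim : Tendsto (fun α : ℝ => 1 + g (s ^ 2) * s / α) atTop (nhds 1) := by
        simpa using (tendsto_const_nhds (x := g (s ^ 2) * s)).div_atTop tendsto_id |>.const_add 1
      refine tendsto_of_tendsto_of_tendsto_of_le_of_le' tendsto_const_nhds hlim ?_ ?_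
      · filter_upwards [eventually_gt_atTop 0] with α hα using hone α hα s hs
      · filter_upwards [eventually_gt_atTop 0] with α hα
        have := sub_one_le_profileMap_one hN0 (hone α hα s hs)
        rw [hscale α hα s hs] at this
        linarith
    have hlim : Tendsto (fun α : ℝ => s * Gfun g (s ^ 2) /
        (1 + ((N : ℝ) - 1) * ((Ψ α s / α)⁻¹) ^ N)) atTop
        (nhds (s * Gfun g (s ^ 2) / (1 + ((N : ℝ) - 1) * (1⁻¹) ^ N))) := by
      refine Tendsto.div tendsto_const_nhds
        ((((hq.inv₀ one_ne_zero).pow N).const_mul _).const_add 1) ?_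
      rw [inv_one, one_pow]
      linarith
    have hval : s * Gfun g (s ^ 2) / (1 + ((N : ℝ) - 1) * (1⁻¹) ^ N) =
        (1 / N : ℝ) * (s * Gfun g (s ^ 2)) := by
      rw [inv_one, one_pow]
      ring
    rw [hval] at hlim
    refine hlim.congr' ?_
    filter_upwards [eventually_gt_atTop 0] with α hα using (hform α hα s hs).symm

end
end
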